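/- arXiv:2205.12904 — 4 statements merged into one kernel-verified Lean document; each statement's English description precedes it below -/
import Mathlib

section
/- Fix F ≥ 1, D ≥ 1, a decision function σ, and inputs x_i, x_j ∈ ℝ^F. Then the empirical NTK at the NTK initialization of an ensemble of M soft perfect binary trees of depth D, Θ̂₀^M(x_i,x_j), converges in probability as M → ∞ to the deterministic value Θ^{(D,PB)}(x_i,x_j) = 2^D·D·Σ(x_i,x_j)·T(x_i,x_j)^{D−1}·Ṫ(x_i,x_j) + (2·T(x_i,x_j))^D. -/
open MeasureTheory ProbabilityTheory Filter

noncomputable section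

/-- Euclidean inner product on `ℝ^F`. -/
def dot {F : ℕ} (u x : Fin F → ℝ) : ℝ := ∑ k, u k * x k

/-- Standard Gaussian measure on `ℝ^F` (zero mean, identity covariance). -/
def stdGauss (F : ℕ) : Measure (Fin F → ℝ) := Measure.pi fun _ => gaussianReal 0 1

/-- `T(x_i,x_j) = E[σ(uᵀx_i)·σ(uᵀx_j)]` for `u` standard Gaussian. -/
def Tker {F : ℕ} (σ : ℝ → ℝ) (xi xj : Fin F → ℝ) : ℝ :=
  ∫ u, σ (dot u xi) * σ (dot u xj) ∂ stdGauss F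

/-- `Ṫ(x_i,x_j) = E[σ̇(uᵀx_i)·σ̇(uᵀx_j)]` for `u` standard Gaussian. -/
def Tdot {F : ℕ} (σ : ℝ → ℝ) (xi xj : Fin F → ℝ) : ℝ :=
  ∫ u, deriv σ (dot u xi) * deriv σ (dot u xj) ∂ stdGauss F

/-- A decision function: differentiable with bounded derivative, values in [0,1],
and `σ(p) + σ(−p) = 1`. -/
structure IsDecisionFunc (σ : ℝ → ℝ) : Prop where
  differentiable : Differentiable ℝ σ
  deriv_bounded : ∃ C : ℝ, ∀ p : ℝ, |deriv σ p| ≤ C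
  mem_Icc : ∀ p : ℝ, σ p ∈ Set.Icc (0:ℝ) 1
  symm : ∀ p : ℝ, σ p + σ (-p) = 1

/-- A tree architecture: a finite full binary tree. -/
inductive BTree where
  | leaf : BTree
  | node : BTree → BTree → BTree

namespace BTree

/-- Root-to-leaf paths (`true` = go to the left child). -/
def leafPaths : BTree → List (List Bool)
  | .leaf => [[]]
  | .node l r => l.leafPaths.map (List.cons true) ++ r.leafPaths.map (List.cons false)

/-- Addresses of internal nodes. -/
def nodePaths : BTree → List (List Bool)
  | .leaf => []
  | .node l r => [] :: (l.nodePaths.map (List.cons true) ++ r.nodePaths.map (List.cons false))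

/-- Maximal leaf depth. -/
def depth : BTree → ℕ
  | .leaf => 0
  | .node l r => max l.depth r.depth + 1

/-- `Q(d)`: the number of leaves at depth `d`. -/
def Q (t : BTree) (d : ℕ) : ℕ := (t.leafPaths.filter fun p => p.length = d).length

def nodeFinset (t : BTree) : Finset (List Bool) := t.nodePaths.toFinset
def leafFinset (t : BTree) : Finset (List Bool) := t.leafPaths.toFinset

end BTree

/-- Index type for the scalar trainable parameters of a single soft tree with
architecture `t` on `ℝ^F`: one scalar per coordinate of each internal-node weight
vector, and one scalar per leaf. -/
abbrev TParam (t : BTree) (F : ℕ) : Type := (↥t.nodeFinset × Fin F) ⊕ ↥t.leafFinset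

/-- The internal-node weight vector at address `a`, read from a parameter vector. -/
def wOf (t : BTree) {F : ℕ} (θ : TParam t F → ℝ) (a : List Bool) : Fin F → ℝ :=
  fun k => if h : a ∈ t.nodeFinset then θ (Sum.inl (⟨a, h⟩, k)) else 0

/-- The leaf value at leaf address `a`, read from a parameter vector. -/
def piOf (t : BTree) {F : ℕ} (θ : TParam t F → ℝ) (a : List Bool) : ℝ :=
  if h : a ∈ t.leafFinset then θ (Sum.inr ⟨a, h⟩) else 0

/-- Product along a root-to-leaf path of `p` (at a node passed leftwards) or `1 - p`
(passed rightwards), where `p` assigns a real to every node address. -/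
def pathProd (p : List Bool → ℝ) : List Bool → ℝ
  | [] => 1
  | b :: rest => (if b then p [] else 1 - p []) * pathProd (fun a => p (b :: a)) rest

/-- Output of a single soft tree: `f(x) = ∑_ℓ π_ℓ · μ_ℓ(x, w)`. -/
def treeF {F : ℕ} (σ : ℝ → ℝ) (t : BTree) (θ : TParam t F → ℝ) (x : Fin F → ℝ) : ℝ :=
  (t.leafPaths.map fun path =>
    piOf t θ path * pathProd (fun a => σ (dot (wOf t θ a) x)) path).sum

/-- Output of an ensemble of `M` soft trees: `f^M(x) = (1/√M) ∑_m f_m(x)`. -/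
def ensembleF {F : ℕ} (σ : ℝ → ℝ) (t : BTree) (M : ℕ) (θ : Fin M × TParam t F → ℝ)
    (x : Fin F → ℝ) : ℝ :=
  (1 / Real.sqrt M) * ∑ m : Fin M, treeF σ t (fun p => θ (m, p)) x

/-- Partial derivative of `g` with respect to the scalar parameter indexed by `q`. -/
def pderiv {ι : Type} [DecidableEq ι] (g : (ι → ℝ) → ℝ) (θ : ι → ℝ) (q : ι) : ℝ :=
  deriv (fun s => g (Function.update θ q s)) (θ q)

/-- Empirical NTK of a model `g` with scalar parameters indexed by `ι`:
`Θ̂(x_i,x_j) = ∑_θ (∂g(x_i)/∂θ)·(∂g(x_j)/∂θ)`. -/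
def empNTK {ι : Type} [Fintype ι] [DecidableEq ι] {F : ℕ}
    (g : (ι → ℝ) → (Fin F → ℝ) → ℝ) (θ : ι → ℝ) (xi xj : Fin F → ℝ) : ℝ :=
  ∑ q : ι, pderiv (fun θ' => g θ' xi) θ q * pderiv (fun θ' => g θ' xj) θ q

/-- NTK initialization: all scalar parameters are i.i.d. standard Gaussian. -/
def initMeasure (ι : Type) [Fintype ι] : Measure (ι → ℝ) :=
  Measure.pi fun _ => gaussianReal 0 1

/-- The perfect binary tree of depth `D`. -/
def perfectTree : ℕ → BTree
  | 0 => .leaf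
  | n + 1 => .node (perfectTree n) (perfectTree n)

def sideOf : List Bool → List Bool → Option Bool
  | [], _ => none
  | b :: _, [] => some b
  | b :: l, c :: a => if b = c then sideOf l a else none

def pS : Option Bool → ℝ → ℝ
  | none, _ => 1
  | some true, v => v
  | some false, v => 1 - v

def gS (σ : ℝ → ℝ) : Option Bool → ℝ → ℝ
  | none, _ => 1
  | some true, p => σ p
  | some false, p => 1 - σ p

def gD (σ : ℝ → ℝ) : Option Bool → ℝ → ℝ
  | none, _ => 0
  | some true, p => deriv σ p
  | some false, p => - deriv σ p

theorem pS_eq_gS (σ : ℝ → ℝ) (s : Option Bool) (p : ℝ) : pS s (σ p) = gS σ s p := by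
  rcases s with _ | _ | _ <;> rfl

theorem pathProd_list (t : BTree) : ∀ (p : List Bool → ℝ) (l : List Bool), l ∈ t.leafPaths →
    pathProd p l = (t.nodePaths.map (fun a => pS (sideOf l a) (p a))).prod := by
  induction t with
  | leaf =>
    intro p l hl
    simp [BTree.leafPaths] at hl
    subst hl
    simp [pathProd, BTree.nodePaths]
  | node tl tr ihl ihr =>
    intro p l hl
    simp only [BTree.leafPaths, List.mem_append, List.mem_map] at hl
    rcases hl with ⟨a, ha, rfl⟩ | ⟨a, ha, rfl⟩
    · simp [pathProd, BTree.nodePaths, ihl _ a ha, Function.comp_def, sideOf, pS]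
    · simp [pathProd, BTree.nodePaths, ihr _ a ha, Function.comp_def, sideOf, pS]

theorem count_list (t : BTree) : ∀ (l : List Bool), l ∈ t.leafPaths →
    (t.nodePaths.map (fun a => if (sideOf l a).isSome then 1 else 0)).sum = l.length := by
  induction t with
  | leaf =>
    intro l hl
    simp [BTree.leafPaths] at hl
    subst hl
    simp [BTree.nodePaths]
  | node tl tr ihl ihr =>
    intro l hl
    simp only [BTree.leafPaths, List.mem_append, List.mem_map] at hl
    rcases hl with ⟨a, ha, rfl⟩ | ⟨a, ha, rfl⟩
    · have := ihl a ha
      simp [BTree.nodePaths, Function.comp_def, sideOf, this, add_comm]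
    · have := ihr a ha
      simp [BTree.nodePaths, Function.comp_def, sideOf, this, add_comm]

theorem nodup_leaf (t : BTree) : t.leafPaths.Nodup := by
  induction t with
  | leaf => simp [BTree.leafPaths]
  | node tl tr ihl ihr =>
    simp only [BTree.leafPaths]
    refine List.Nodup.append (ihl.map (List.cons_injective)) (ihr.map (List.cons_injective)) ?_
    intro x hx hy
    simp only [List.mem_map] at hx hy
    obtain ⟨a, _, rfl⟩ := hx
    obtain ⟨b, _, hb⟩ := hy
    simp at hb

theorem nodup_node (t : BTree) : t.nodePaths.Nodup := by
  induction t with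
  | leaf => simp [BTree.nodePaths]
  | node tl tr ihl ihr =>
    simp only [BTree.nodePaths]
    refine List.Nodup.cons (by simp) (List.Nodup.append (ihl.map (List.cons_injective))
      (ihr.map (List.cons_injective)) ?_)
    intro x hx hy
    simp only [List.mem_map] at hx hy
    obtain ⟨a, _, rfl⟩ := hx
    obtain ⟨b, _, hb⟩ := hy
    simp at hb

theorem perfect_len (D : ℕ) : ∀ l ∈ (perfectTree D).leafPaths, l.length = D := by
  induction D with
  | zero => simp [perfectTree, BTree.leafPaths]
  | succ n ih =>
    intro l hl
    simp only [perfectTree, BTree.leafPaths, List.mem_append, List.mem_map] at hl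
    rcases hl with ⟨a, ha, rfl⟩ | ⟨a, ha, rfl⟩ <;> simp [ih a ha]

theorem perfect_card (D : ℕ) : (perfectTree D).leafPaths.length = 2 ^ D := by
  induction D with
  | zero => simp [perfectTree, BTree.leafPaths]
  | succ n ih => simp [perfectTree, BTree.leafPaths, ih, pow_succ]; ring

theorem count_card (t : BTree) (l : ↥t.leafFinset) :
    (Finset.univ.filter (fun a : ↥t.nodeFinset => (sideOf l a).isSome)).card
      = (l : List Bool).length := by
  have hl : (l : List Bool) ∈ t.leafPaths := List.mem_toFinset.1 l.2
  rw [Finset.card_filter, Finset.sum_coe_sort t.nodeFinset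
    (fun a => if (sideOf l a).isSome then 1 else 0), ← count_list t l hl, BTree.nodeFinset,
    List.sum_toFinset _ (nodup_node t)]

def dotP (t : BTree) {F : ℕ} (θ : TParam t F → ℝ) (x : Fin F → ℝ) (a : ↥t.nodeFinset) : ℝ :=
  dot (fun k => θ (Sum.inl (a, k))) x

theorem treeF_eq {F : ℕ} (σ : ℝ → ℝ) (t : BTree) (θ : TParam t F → ℝ) (x : Fin F → ℝ) :
    treeF σ t θ x = ∑ l : ↥t.leafFinset, θ (Sum.inr l) *
      ∏ a : ↥t.nodeFinset, gS σ (sideOf l a) (dotP t θ x a) := by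
  unfold treeF
  rw [← List.sum_toFinset _ (nodup_leaf t)]
  change ∑ l ∈ t.leafFinset, _ = _
  rw [← Finset.sum_coe_sort]
  refine Finset.sum_congr rfl fun l _ => ?_
  have hl : (l : List Bool) ∈ t.leafPaths := List.mem_toFinset.1 l.2
  rw [pathProd_list t _ _ hl, ← List.prod_toFinset _ (nodup_node t)]
  change _ * (∏ a ∈ t.nodeFinset, _) = _
  rw [← Finset.prod_coe_sort]
  congr 1
  · simp [piOf]
  · refine Finset.prod_congr rfl fun a _ => ?_
    rw [pS_eq_gS]
    congr 1
    have : wOf t θ a = fun k => θ (Sum.inl (a, k)) := by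
      funext k
      simp [wOf]
    rw [dotP, this]

theorem gS_hasDeriv {σ : ℝ → ℝ} (hσ : Differentiable ℝ σ) (s : Option Bool) (p : ℝ) :
    HasDerivAt (gS σ s) (gD σ s p) p := by
  have h := (hσ p).hasDerivAt
  rcases s with _ | _ | _
  · exact hasDerivAt_const _ _
  · exact h.const_sub 1
  · exact h

/-- leaf product -/
def muP {F : ℕ} (σ : ℝ → ℝ) (t : BTree) (θ : TParam t F → ℝ) (x : Fin F → ℝ)
    (l : ↥t.leafFinset) : ℝ :=
  ∏ a : ↥t.nodeFinset, gS σ (sideOf l a) (dotP t θ x a)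

/-- differentiated leaf product -/
def dP {F : ℕ} (σ : ℝ → ℝ) (t : BTree) (θ : TParam t F → ℝ) (x : Fin F → ℝ)
    (l : ↥t.leafFinset) (n : ↥t.nodeFinset) : ℝ :=
  ∏ a : ↥t.nodeFinset, (if a = n then gD σ else gS σ) (sideOf l a) (dotP t θ x a)

theorem pderiv_inr {F : ℕ} (σ : ℝ → ℝ) (t : BTree) (θ : TParam t F → ℝ) (x : Fin F → ℝ)
    (l : ↥t.leafFinset) :
    pderiv (fun θ' => treeF σ t θ' x) θ (Sum.inr l) = muP σ t θ x l := by
  unfold pderiv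
  have hd : ∀ s a, dotP t (Function.update θ (Sum.inr l) s) x a = dotP t θ x a := by
    intro s a; simp [dotP]
  have : ∀ s, treeF σ t (Function.update θ (Sum.inr l) s) x =
      s * muP σ t θ x l + ∑ l' ∈ Finset.univ.erase l, θ (Sum.inr l') * muP σ t θ x l' := by
    intro s
    rw [treeF_eq]
    simp only [hd]
    rw [← Finset.add_sum_erase _ _ (Finset.mem_univ l)]
    congr 1
    · simp [muP]
    · refine Finset.sum_congr rfl fun l' hl' => ?_
      have : l' ≠ l := Finset.ne_of_mem_erase hl'
      simp [Function.update_of_ne, this, muP]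
  simp only [this]
  rw [deriv_add_const]
  simp

theorem pderiv_inl {F : ℕ} {σ : ℝ → ℝ} (hσ : Differentiable ℝ σ) (t : BTree)
    (θ : TParam t F → ℝ) (x : Fin F → ℝ) (n : ↥t.nodeFinset) (k : Fin F) :
    pderiv (fun θ' => treeF σ t θ' x) θ (Sum.inl (n, k)) =
      ∑ l, θ (Sum.inr l) * (x k * dP σ t θ x l n) := by
  unfold pderiv
  refine HasDerivAt.deriv ?_
  simp only [treeF_eq]
  refine HasDerivAt.fun_sum fun l _ => ?_
  simp only [Function.update_of_ne (show (Sum.inr l : TParam t F) ≠ Sum.inl (n, k) by simp)]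
  refine HasDerivAt.const_mul _ ?_
  have hne : ∀ s (a : ↥t.nodeFinset), a ≠ n →
      dotP t (Function.update θ (Sum.inl (n, k)) s) x a = dotP t θ x a := by
    intro s a ha
    simp [dotP, Function.update_of_ne, ha]
  have hdot : HasDerivAt (fun s => dotP t (Function.update θ (Sum.inl (n, k)) s) x n) (x k)
      (θ (Sum.inl (n, k))) := by
    unfold dotP dot
    have h1 := hasDerivAt_pi.1 (hasDerivAt_update θ (Sum.inl (n, k)) (θ (Sum.inl (n, k))))
    have h2 := HasDerivAt.fun_sum (u := Finset.univ) fun (k' : Fin F) _ =>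
      (h1 (Sum.inl (n, k'))).mul_const (x k')
    convert! h2 using 1
    simp [Pi.single_apply]
  have hself : dotP t (Function.update θ (Sum.inl (n, k)) (θ (Sum.inl (n, k)))) x n
      = dotP t θ x n := by simp
  have hg := gS_hasDeriv hσ (sideOf l n)
    (dotP t (Function.update θ (Sum.inl (n, k)) (θ (Sum.inl (n, k)))) x n)
  have h3 := (HasDerivAt.comp (θ (Sum.inl (n, k))) (h := fun s => dotP t (Function.update θ (Sum.inl (n, k)) s) x n) hg hdot).mul_const
    (∏ a ∈ Finset.univ.erase n, gS σ (sideOf l a) (dotP t θ x a))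
  convert! h3 using 1
  · funext s
    rw [← Finset.mul_prod_erase _ _ (Finset.mem_univ n)]
    congr 1
    refine Finset.prod_congr rfl fun a ha => ?_
    rw [hne s a (Finset.ne_of_mem_erase ha)]
  · rw [hself, dP, ← Finset.mul_prod_erase _ _ (Finset.mem_univ n)]
    have : ∏ a ∈ Finset.univ.erase n, (if a = n then gD σ else gS σ) (sideOf l a) (dotP t θ x a)
        = ∏ a ∈ Finset.univ.erase n, gS σ (sideOf l a) (dotP t θ x a) := by
      refine Finset.prod_congr rfl fun a ha => ?_
      rw [if_neg (Finset.ne_of_mem_erase ha)]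
    rw [this, if_pos rfl]
    ring

theorem pderiv_ens {F : ℕ} (σ : ℝ → ℝ) (t : BTree) (M : ℕ) (θ : Fin M × TParam t F → ℝ)
    (x : Fin F → ℝ) (m : Fin M) (q : TParam t F) :
    pderiv (fun θ' => ensembleF σ t M θ' x) θ (m, q) =
      (1 / Real.sqrt M) * pderiv (fun θ' => treeF σ t θ' x) (fun p => θ (m, p)) q := by
  unfold pderiv ensembleF
  rw [deriv_const_mul_field]
  congr 1
  have : ∀ s, ∑ m' : Fin M, treeF σ t (fun p => Function.update θ (m, q) s (m', p)) x =
      treeF σ t (Function.update (fun p => θ (m, p)) q s) x +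
      ∑ m' ∈ Finset.univ.erase m, treeF σ t (fun p => θ (m', p)) x := by
    intro s
    rw [← Finset.add_sum_erase _ _ (Finset.mem_univ m)]
    congr 1
    · congr 1
      funext p
      simp [Function.update_apply]
    · refine Finset.sum_congr rfl fun m' hm' => ?_
      have := Finset.ne_of_mem_erase hm'
      congr 1
      funext p
      simp [this]
  simp only [this]
  rw [deriv_add_const]

theorem empNTK_ens {F : ℕ} (σ : ℝ → ℝ) (t : BTree) (M : ℕ) (θ : Fin M × TParam t F → ℝ)
    (xi xj : Fin F → ℝ) :
    empNTK (ensembleF σ t M) θ xi xj =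
      (1 / (M : ℝ)) * ∑ m : Fin M, empNTK (treeF σ t) (fun p => θ (m, p)) xi xj := by
  unfold empNTK
  rw [Fintype.sum_prod_type, Finset.mul_sum]
  refine Finset.sum_congr rfl fun m _ => ?_
  rw [Finset.mul_sum]
  refine Finset.sum_congr rfl fun q _ => ?_
  rw [pderiv_ens, pderiv_ens]
  have : (1 / (M : ℝ)) = (1 / Real.sqrt M) * (1 / Real.sqrt M) := by
    rw [div_mul_div_comm, Real.mul_self_sqrt (Nat.cast_nonneg M)]; simp
  rw [this]; ring

theorem mp_uncurry {ι κ : Type} [Fintype ι] [Fintype κ] :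
    MeasurePreserving (MeasurableEquiv.curry ι κ ℝ).symm
      (Measure.pi fun _ : ι => initMeasure κ) (initMeasure (ι × κ)) where
  measurable := (MeasurableEquiv.curry ι κ ℝ).symm.measurable
  map_eq := by
    have : IsProbabilityMeasure (initMeasure κ) := by unfold initMeasure; infer_instance
    refine (Measure.pi_eq fun s hs => ?_).symm
    rw [MeasurableEquiv.map_apply]
    have : (MeasurableEquiv.curry ι κ ℝ).symm ⁻¹' (Set.univ.pi s) =
        Set.univ.pi fun i => Set.univ.pi fun j => s (i, j) := by
      ext f
      simp [Set.mem_pi, MeasurableEquiv.coe_curry_symm, Function.uncurry]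
    rw [this, Measure.pi_pi, Fintype.prod_prod_type]
    simp [initMeasure, Measure.pi_pi]

theorem mp_curry {ι κ : Type} [Fintype ι] [Fintype κ] :
    MeasurePreserving (MeasurableEquiv.curry ι κ ℝ) (initMeasure (ι × κ))
      (Measure.pi fun _ : ι => initMeasure κ) := mp_uncurry.symm

instance initProb (κ : Type) [Fintype κ] : IsProbabilityMeasure (initMeasure κ) := by
  unfold initMeasure; infer_instance

instance stdProb (F : ℕ) : IsProbabilityMeasure (stdGauss F) := by
  unfold stdGauss; infer_instance

theorem wlln {κ : Type} [Fintype κ] (X : (κ → ℝ) → ℝ) (hX : MemLp X 2 (initMeasure κ))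
    (ε : ℝ) (hε : 0 < ε) :
    Tendsto (fun M : ℕ => initMeasure (Fin M × κ)
      {θ | ε ≤ |(1 / (M : ℝ)) * ∑ m : Fin M, X (fun p => θ (m, p)) - ∫ θ, X θ ∂initMeasure κ|})
      atTop (nhds 0) := by
  have key : ∀ M : ℕ, 0 < M → initMeasure (Fin M × κ)
      {θ | ε ≤ |(1 / (M : ℝ)) * ∑ m : Fin M, X (fun p => θ (m, p)) - ∫ θ, X θ ∂initMeasure κ|}
      ≤ ENNReal.ofReal ((Var[X; initMeasure κ] / ε ^ 2) / M) := by
    intro M hM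
    have hM' : (M : ℝ) ≠ 0 := by positivity
    let P : Measure (Fin M → κ → ℝ) := Measure.pi fun _ => initMeasure κ
    let S : (Fin M → κ → ℝ) → ℝ := fun ω => ∑ m : Fin M, X (ω m)
    let Y : (Fin M → κ → ℝ) → ℝ := fun ω => (1 / (M : ℝ)) * S ω
    have hXm : ∀ m : Fin M, MemLp (fun ω : Fin M → κ → ℝ => X (ω m)) 2 P := fun m =>
      hX.comp_measurePreserving (measurePreserving_eval (fun _ : Fin M => initMeasure κ) m)
    have hS : MemLp S 2 P := memLp_finsetSum _ fun m _ => hXm m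
    have hY : MemLp Y 2 P := hS.const_mul _
    have hES : ∫ ω, S ω ∂P = M * ∫ θ, X θ ∂initMeasure κ := by
      simp only [S]
      rw [integral_finsetSum _ fun m _ => (hXm m).integrable (by norm_num)]
      have : ∀ m : Fin M, ∫ ω, X (ω m) ∂P = ∫ θ, X θ ∂initMeasure κ := by
        intro m
        have h := measurePreserving_eval (fun _ : Fin M => initMeasure κ) m
        rw [← h.map_eq, integral_map h.measurable.aemeasurable]
        rw [h.map_eq]; exact hX.1
      simp [this]
    have hEY : ∫ ω, Y ω ∂P = ∫ θ, X θ ∂initMeasure κ := by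
      simp only [Y]
      rw [integral_const_mul, hES]
      field_simp
    have hVS : Var[S; P] = M * Var[X; initMeasure κ] := by
      have h := variance_sum_pi (ι := Fin M) (μ := fun _ => initMeasure κ) (X := fun _ => X)
        (fun _ => hX)
      have h2 : (∑ i : Fin M, fun ω : Fin M → κ → ℝ => X (ω i)) = S := by
        funext ω; simp [S]
      rw [h2] at h
      simpa using h
    have hVY : Var[Y; P] = Var[X; initMeasure κ] / M := by
      simp only [Y]
      rw [variance_const_mul, hVS]
      field_simp
    have hch := meas_ge_le_variance_div_sq hY hε
    rw [hEY, hVY] at hch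
    have hpre := (mp_curry (ι := Fin M) (κ := κ)).measure_preimage_equiv
      {ω | ε ≤ |Y ω - ∫ θ, X θ ∂initMeasure κ|}
    have : Var[X; initMeasure κ] / ε ^ 2 / M = Var[X; initMeasure κ] / M / ε ^ 2 := by
      field_simp
    rw [this]
    refine le_trans (le_of_eq ?_) hch
    rw [← hpre]
    rfl
  have hlim : Tendsto (fun M : ℕ => ENNReal.ofReal ((Var[X; initMeasure κ] / ε ^ 2) / M)) atTop
      (nhds 0) := by
    have := ENNReal.tendsto_ofReal
      (tendsto_const_div_atTop_nhds_zero_nat (Var[X; initMeasure κ] / ε ^ 2))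
    simpa using this
  refine tendsto_of_tendsto_of_tendsto_of_le_of_le' tendsto_const_nhds hlim
    (Eventually.of_forall fun _ => zero_le) ?_
  filter_upwards [eventually_gt_atTop 0] with M hM using key M hM

theorem integral_split (t : BTree) (F : ℕ) (g : (↥t.leafFinset → ℝ) → ℝ)
    (h : ↥t.nodeFinset → (Fin F → ℝ) → ℝ) :
    ∫ θ, g (fun l => θ (Sum.inr l)) * ∏ a, h a (fun k => θ (Sum.inl (a, k)))
      ∂initMeasure (TParam t F) =
    (∫ p, g p ∂initMeasure ↥t.leafFinset) * ∏ a, ∫ u, h a u ∂stdGauss F := by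
  have h1 : MeasurePreserving (MeasurableEquiv.sumPiEquivProdPi (fun _ : TParam t F => ℝ))
      (initMeasure (TParam t F)) ((initMeasure (↥t.nodeFinset × Fin F)).prod
        (initMeasure ↥t.leafFinset)) :=
    measurePreserving_sumPiEquivProdPi (fun _ : TParam t F => gaussianReal 0 1)
  have h2 := (mp_curry (ι := ↥t.nodeFinset) (κ := Fin F)).prod
    (MeasurePreserving.id (initMeasure ↥t.leafFinset))
  have h4 : MeasurePreserving ((MeasurableEquiv.sumPiEquivProdPi (fun _ : TParam t F => ℝ)).trans
      (MeasurableEquiv.prodCongr (MeasurableEquiv.curry ↥t.nodeFinset (Fin F) ℝ)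
        (MeasurableEquiv.refl (↥t.leafFinset → ℝ)))) (initMeasure (TParam t F)) _ := h2.comp h1
  have h3 := h4.integral_comp' (fun z : (↥t.nodeFinset → Fin F → ℝ) × (↥t.leafFinset → ℝ) =>
      (∏ a, h a (z.1 a)) * g z.2)
  rw [integral_prod_mul (fun w : ↥t.nodeFinset → Fin F → ℝ => ∏ a, h a (w a)) g,
    integral_fintype_prod_eq_prod] at h3
  rw [mul_comm]
  refine Eq.trans ?_ h3
  refine integral_congr_ae (Eventually.of_forall fun θ => ?_)
  exact mul_comm _ _

theorem gauss_sq : ∫ x, x * x ∂gaussianReal 0 1 = 1 := by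
  have h := variance_id_gaussianReal (μ := 0) (v := 1)
  rw [variance_eq_integral aemeasurable_id] at h
  simpa [integral_id_gaussianReal, sq] using h

theorem pi_cov {κ : Type} [Fintype κ] [DecidableEq κ] (l l' : κ) :
    ∫ p, p l * p l' ∂initMeasure κ = if l = l' then 1 else 0 := by
  split_ifs with h
  · subst h
    have h := measurePreserving_eval (fun _ : κ => gaussianReal 0 1) l
    rw [← gauss_sq]
    conv_rhs => rw [← h.map_eq]
    rw [integral_map h.measurable.aemeasurable (by fun_prop)]
    rfl
  · have : ∀ p : κ → ℝ, p l * p l' =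
        ∏ i, (if i = l then p i else 1) * (if i = l' then p i else 1) := by
      intro p
      rw [Finset.prod_mul_distrib]
      simp
    simp only [this]
    rw [initMeasure, integral_fintype_prod_eq_prod
      (fun i (y : ℝ) => (if i = l then y else 1) * (if i = l' then y else 1))]
    refine Finset.prod_eq_zero (Finset.mem_univ l) ?_
    simp [h, integral_id_gaussianReal]

theorem mp_neg (F : ℕ) : MeasurePreserving (fun u : Fin F → ℝ => fun k => - u k)
    (stdGauss F) (stdGauss F) := by
  refine measurePreserving_pi (f := fun _ (y : ℝ) => -y) _ _ fun _ => ⟨measurable_neg, ?_⟩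
  have := gaussianReal_map_neg (μ := 0) (v := 1)
  simpa using this

theorem dot_meas {F : ℕ} (x : Fin F → ℝ) : Measurable (fun u => dot u x) := by
  unfold dot; fun_prop

theorem gS_meas {σ : ℝ → ℝ} (hσ : IsDecisionFunc σ) (s : Option Bool) : Measurable (gS σ s) := by
  have := hσ.differentiable.continuous.measurable
  rcases s with _ | _ | _
  · exact measurable_const
  · exact measurable_const.sub this
  · exact this

theorem gD_meas (σ : ℝ → ℝ) (s : Option Bool) : Measurable (gD σ s) := by
  have := measurable_deriv σ
  rcases s with _ | _ | _
  · exact measurable_const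
  · exact this.neg
  · exact this

theorem int_gS {F : ℕ} {σ : ℝ → ℝ} (hσ : IsDecisionFunc σ) (xi xj : Fin F → ℝ)
    (s : Option Bool) :
    ∫ u, gS σ s (dot u xi) * gS σ s (dot u xj) ∂stdGauss F =
      if s.isSome then Tker σ xi xj else 1 := by
  rcases s with _ | _ | _
  · simp [gS]
  · have e : ∀ p, 1 - σ p = σ (-p) := fun p => by linarith [hσ.symm p]
    have ed : ∀ (u x : Fin F → ℝ), - dot u x = dot (fun k => - u k) x := by
      intro u x; simp [dot]
    simp only [gS, e, ed]
    have h := mp_neg F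
    have hm : Measurable (fun u : Fin F → ℝ => σ (dot u xi) * σ (dot u xj)) :=
      (hσ.differentiable.continuous.measurable.comp (dot_meas xi)).mul
        (hσ.differentiable.continuous.measurable.comp (dot_meas xj))
    have := integral_map (μ := stdGauss F) h.measurable.aemeasurable
      (f := fun u : Fin F → ℝ => σ (dot u xi) * σ (dot u xj)) hm.aestronglyMeasurable
    rw [h.map_eq] at this
    rw [← this]
    rfl
  · rfl

theorem int_gD {F : ℕ} (σ : ℝ → ℝ) (xi xj : Fin F → ℝ) (s : Option Bool) :
    ∫ u, gD σ s (dot u xi) * gD σ s (dot u xj) ∂stdGauss F =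
      if s.isSome then Tdot σ xi xj else 0 := by
  rcases s with _ | _ | _
  · simp [gD]
  · simp [gD, Tdot]
  · simp [gD, Tdot]

theorem dotP_meas (t : BTree) {F : ℕ} (x : Fin F → ℝ) (a : ↥t.nodeFinset) :
    Measurable (fun θ : TParam t F → ℝ => dotP t θ x a) := by
  unfold dotP dot; fun_prop

theorem gS_abs {σ : ℝ → ℝ} (hσ : IsDecisionFunc σ) (s : Option Bool) (p : ℝ) :
    |gS σ s p| ≤ 1 := by
  have h := hσ.mem_Icc p
  rw [abs_le]
  rcases s with _ | _ | _ <;> simp only [gS] <;> constructor <;> linarith [h.1, h.2]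

theorem muP_memLp {F : ℕ} {σ : ℝ → ℝ} (hσ : IsDecisionFunc σ) (t : BTree) (x : Fin F → ℝ)
    (l : ↥t.leafFinset) :
    MemLp (fun θ => muP σ t θ x l) ⊤ (initMeasure (TParam t F)) := by
  refine memLp_top_of_bound (Measurable.aestronglyMeasurable ?_) 1 (Eventually.of_forall ?_)
  · unfold muP
    exact Finset.measurable_prod _ fun a _ => (gS_meas hσ _).comp (dotP_meas t x a)
  · intro θ
    rw [Real.norm_eq_abs, muP, Finset.abs_prod]
    exact Finset.prod_le_one (fun _ _ => abs_nonneg _) fun a _ => gS_abs hσ _ _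

theorem dP_memLp {F : ℕ} {σ : ℝ → ℝ} (hσ : IsDecisionFunc σ) (t : BTree) (x : Fin F → ℝ)
    (l : ↥t.leafFinset) (n : ↥t.nodeFinset) :
    MemLp (fun θ => dP σ t θ x l n) ⊤ (initMeasure (TParam t F)) := by
  obtain ⟨C, hC⟩ := hσ.deriv_bounded
  refine memLp_top_of_bound (Measurable.aestronglyMeasurable ?_)
    (∏ _a : ↥t.nodeFinset, max C 1) (Eventually.of_forall ?_)
  · unfold dP
    refine Finset.measurable_prod _ fun a _ => ?_
    split_ifs
    · exact (gD_meas σ _).comp (dotP_meas t x a)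
    · exact (gS_meas hσ _).comp (dotP_meas t x a)
  · intro θ
    rw [Real.norm_eq_abs, dP, Finset.abs_prod]
    refine Finset.prod_le_prod (fun _ _ => abs_nonneg _) fun a _ => ?_
    split_ifs
    · refine le_trans ?_ (le_max_left _ _)
      have hc := hC (dotP t θ x a)
      have h0 := (abs_nonneg _).trans hc
      rcases sideOf l a with _ | _ | _ <;> simpa [gD] using by assumption
    · exact (gS_abs hσ _ _).trans (le_max_right _ _)

instance holder442 : ENNReal.HolderTriple 4 4 2 where
  inv_add_inv_eq_inv := by
    rw [← two_mul, show (4 : ENNReal) = 2 * 2 by norm_num,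
      ENNReal.mul_inv (by simp) (by simp), ← mul_assoc,
      ENNReal.mul_inv_cancel (by simp) (by simp), one_mul]

theorem pd_memLp {F : ℕ} {σ : ℝ → ℝ} (hσ : IsDecisionFunc σ) (t : BTree) (x : Fin F → ℝ)
    (q : TParam t F) :
    MemLp (fun θ => pderiv (fun θ' => treeF σ t θ' x) θ q) 4 (initMeasure (TParam t F)) := by
  rcases q with ⟨n, k⟩ | l
  · simp only [pderiv_inl hσ.differentiable]
    refine memLp_finsetSum _ fun l _ => ?_
    have h1 : MemLp (fun θ : TParam t F → ℝ => θ (Sum.inr l)) 4 (initMeasure (TParam t F)) :=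
      (memLp_id_gaussianReal' 4 (by simp)).comp_measurePreserving
        (measurePreserving_eval (fun _ : TParam t F => gaussianReal 0 1) (Sum.inr l))
    exact ((dP_memLp hσ t x l n).const_mul (x k)).mul' h1
  · simp only [pderiv_inr]
    exact (muP_memLp hσ t x l).mono_exponent le_top

theorem pdpd_memLp {F : ℕ} {σ : ℝ → ℝ} (hσ : IsDecisionFunc σ) (t : BTree)
    (xi xj : Fin F → ℝ) (q : TParam t F) :
    MemLp (fun θ => pderiv (fun θ' => treeF σ t θ' xi) θ q *
      pderiv (fun θ' => treeF σ t θ' xj) θ q) 2 (initMeasure (TParam t F)) :=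
  (pd_memLp hσ t xj q).mul' (pd_memLp hσ t xi q)

theorem ntk_memLp {F : ℕ} {σ : ℝ → ℝ} (hσ : IsDecisionFunc σ) (t : BTree)
    (xi xj : Fin F → ℝ) :
    MemLp (fun θ => empNTK (treeF σ t) θ xi xj) 2 (initMeasure (TParam t F)) := by
  unfold empNTK
  exact memLp_finsetSum _ fun q _ => pdpd_memLp hσ t xi xj q

theorem exp_mu {F : ℕ} {σ : ℝ → ℝ} (hσ : IsDecisionFunc σ) (t : BTree)
    (xi xj : Fin F → ℝ) (l : ↥t.leafFinset) :
    ∫ θ, muP σ t θ xi l * muP σ t θ xj l ∂initMeasure (TParam t F) =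
      Tker σ xi xj ^ (l : List Bool).length := by
  have h := integral_split t F (fun _ => 1)
    (fun a u => gS σ (sideOf l a) (dot u xi) * gS σ (sideOf l a) (dot u xj))
  simp only [int_gS hσ, Finset.prod_mul_distrib, one_mul] at h
  rw [Finset.prod_ite] at h
  simp only [Finset.prod_const, count_card, integral_const, probReal_univ] at h
  simpa [muP, dotP] using h

theorem exp_d {F : ℕ} {σ : ℝ → ℝ} (hσ : IsDecisionFunc σ) (t : BTree)
    (xi xj : Fin F → ℝ) (l l' : ↥t.leafFinset) (n : ↥t.nodeFinset) :
    ∫ θ, (θ (Sum.inr l) * θ (Sum.inr l')) * (dP σ t θ xi l n * dP σ t θ xj l' n)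
      ∂initMeasure (TParam t F) =
      if l = l' then (if (sideOf l n).isSome then
        Tdot σ xi xj * Tker σ xi xj ^ ((l : List Bool).length - 1) else 0) else 0 := by
  have h := integral_split t F (fun p => p l * p l')
    (fun a u => (if a = n then gD σ else gS σ) (sideOf l a) (dot u xi) *
      (if a = n then gD σ else gS σ) (sideOf l' a) (dot u xj))
  simp only [Finset.prod_mul_distrib] at h
  refine (show _ = _ from h).trans ?_
  rw [pi_cov]
  split_ifs with h1 h2
  · subst h1
    rw [one_mul, ← Finset.mul_prod_erase _ _ (Finset.mem_univ n), if_pos rfl, int_gD, if_pos h2]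
    congr 1
    have : ∀ a ∈ Finset.univ.erase n, ∫ u, (if a = n then gD σ else gS σ) (sideOf l a) (dot u xi) *
        (if a = n then gD σ else gS σ) (sideOf l a) (dot u xj) ∂stdGauss F =
        if (sideOf l a).isSome then Tker σ xi xj else 1 := by
      intro a ha
      rw [if_neg (Finset.ne_of_mem_erase ha), int_gS hσ]
    rw [Finset.prod_congr rfl this, Finset.prod_ite]
    simp only [Finset.prod_const, one_pow, mul_one]
    rw [Finset.filter_erase, Finset.card_erase_of_mem (by simp [h2]), count_card]
  · subst h1
    rw [one_mul]
    refine Finset.prod_eq_zero (Finset.mem_univ n) ?_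
    rw [if_pos rfl, int_gD, if_neg h2]
  · simp

theorem exp_inl {F : ℕ} {σ : ℝ → ℝ} (hσ : IsDecisionFunc σ) (t : BTree)
    (xi xj : Fin F → ℝ) (n : ↥t.nodeFinset) (k : Fin F) :
    ∫ θ, pderiv (fun θ' => treeF σ t θ' xi) θ (Sum.inl (n, k)) *
      pderiv (fun θ' => treeF σ t θ' xj) θ (Sum.inl (n, k)) ∂initMeasure (TParam t F) =
      ∑ l : ↥t.leafFinset, (xi k * xj k) * (if (sideOf l n).isSome then
        Tdot σ xi xj * Tker σ xi xj ^ ((l : List Bool).length - 1) else 0) := by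
  have e : ∀ θ : TParam t F → ℝ, pderiv (fun θ' => treeF σ t θ' xi) θ (Sum.inl (n, k)) *
      pderiv (fun θ' => treeF σ t θ' xj) θ (Sum.inl (n, k)) = ∑ l, ∑ l', (xi k * xj k) *
        ((θ (Sum.inr l) * θ (Sum.inr l')) * (dP σ t θ xi l n * dP σ t θ xj l' n)) := by
    intro θ
    rw [pderiv_inl hσ.differentiable, pderiv_inl hσ.differentiable, Finset.sum_mul_sum]
    refine Finset.sum_congr rfl fun l _ => Finset.sum_congr rfl fun l' _ => ?_
    ring
  have hpi : ∀ l, MemLp (fun θ : TParam t F → ℝ => θ (Sum.inr l)) 4 (initMeasure (TParam t F)) :=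
    fun l => (memLp_id_gaussianReal' 4 (by simp)).comp_measurePreserving
        (measurePreserving_eval (fun _ : TParam t F => gaussianReal 0 1) (Sum.inr l))
  have hint : ∀ l l', Integrable (fun θ : TParam t F → ℝ => (xi k * xj k) *
        ((θ (Sum.inr l) * θ (Sum.inr l')) * (dP σ t θ xi l n * dP σ t θ xj l' n)))
        (initMeasure (TParam t F)) := by
    intro l l'
    have h1 : MemLp (fun θ : TParam t F → ℝ => θ (Sum.inr l) * θ (Sum.inr l')) 2
        (initMeasure (TParam t F)) := (hpi l').mul' (hpi l)
    have h2 : MemLp (fun θ : TParam t F → ℝ => dP σ t θ xi l n * dP σ t θ xj l' n) ⊤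
        (initMeasure (TParam t F)) := (dP_memLp hσ t xj l' n).mul' (dP_memLp hσ t xi l n)
    have h3 : MemLp (fun θ : TParam t F → ℝ => (θ (Sum.inr l) * θ (Sum.inr l')) *
      (dP σ t θ xi l n * dP σ t θ xj l' n)) 2 (initMeasure (TParam t F)) := h2.mul' h1
    exact (h3.integrable (by norm_num)).const_mul _
  simp only [e]
  rw [integral_finsetSum _ fun l _ => integrable_finsetSum _ fun l' _ => hint l l']
  refine Finset.sum_congr rfl fun l _ => ?_
  rw [integral_finsetSum _ fun l' _ => hint l l']
  simp only [integral_const_mul, exp_d hσ]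
  simp

theorem ntk_exp {F : ℕ} {σ : ℝ → ℝ} (hσ : IsDecisionFunc σ) (D : ℕ)
    (xi xj : Fin F → ℝ) :
    ∫ θ, empNTK (treeF σ (perfectTree D)) θ xi xj ∂initMeasure (TParam (perfectTree D) F) =
      (2:ℝ)^D * D * dot xi xj * (Tker σ xi xj)^(D-1) * Tdot σ xi xj
            + (2 * Tker σ xi xj)^D := by
  unfold empNTK
  rw [integral_finsetSum _ fun q _ => (pdpd_memLp hσ _ xi xj q).integrable (by norm_num)]
  rw [Fintype.sum_sum_type, Fintype.sum_prod_type]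
  have hlen : ∀ l : ↥(perfectTree D).leafFinset, (l : List Bool).length = D := fun l =>
    perfect_len D l (List.mem_toFinset.1 l.2)
  have hcard : Fintype.card ↥(perfectTree D).leafFinset = 2 ^ D := by
    rw [Fintype.card_coe, BTree.leafFinset, List.toFinset_card_of_nodup (nodup_leaf _),
      perfect_card]
  congr 1
  · simp only [exp_inl hσ, hlen]
    have : ∀ n : ↥(perfectTree D).nodeFinset, ∑ k, ∑ l : ↥(perfectTree D).leafFinset,
        (xi k * xj k) * (if (sideOf l n).isSome then
          Tdot σ xi xj * Tker σ xi xj ^ (D - 1) else 0) =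
        ∑ l : ↥(perfectTree D).leafFinset, dot xi xj * (if (sideOf l n).isSome then
          Tdot σ xi xj * Tker σ xi xj ^ (D - 1) else 0) := by
      intro n
      rw [Finset.sum_comm]
      refine Finset.sum_congr rfl fun l _ => ?_
      rw [dot, Finset.sum_mul]
    simp only [this]
    rw [Finset.sum_comm]
    have h2 : ∀ l : ↥(perfectTree D).leafFinset, ∑ n : ↥(perfectTree D).nodeFinset,
        dot xi xj * (if (sideOf l n).isSome then
          Tdot σ xi xj * Tker σ xi xj ^ (D - 1) else 0) =
        dot xi xj * (D * (Tdot σ xi xj * Tker σ xi xj ^ (D - 1))) := by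
      intro l
      rw [← Finset.mul_sum, ← Finset.sum_filter, Finset.sum_const, count_card, hlen, nsmul_eq_mul]
    simp only [h2, Finset.sum_const, Finset.card_univ, hcard, nsmul_eq_mul]
    push_cast
    ring
  · simp only [pderiv_inr, exp_mu hσ, hlen, Finset.sum_const, Finset.card_univ, hcard,
      nsmul_eq_mul]
    push_cast
    rw [mul_pow]

theorem stmt0 (F D : ℕ) (hF : 1 ≤ F) (hD : 1 ≤ D) (σ : ℝ → ℝ) (hσ : IsDecisionFunc σ)
    (xi xj : Fin F → ℝ) :
    ∀ ε > (0:ℝ), Tendsto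
      (fun M : ℕ => initMeasure (Fin M × TParam (perfectTree D) F)
        {θ | ε ≤ |empNTK (ensembleF σ (perfectTree D) M) θ xi xj -
          ((2:ℝ)^D * D * dot xi xj * (Tker σ xi xj)^(D-1) * Tdot σ xi xj
            + (2 * Tker σ xi xj)^D)|})
      atTop (nhds 0) := by
  intro ε hε
  have h := wlln _ (ntk_memLp hσ (perfectTree D) xi xj) ε hε
  simp only [ntk_exp hσ] at h
  simp only [empNTK_ens]
  exact h

end
end

section
/- Let σ be the scaled error function with scaling factor α > 0 and u a standard Gaussian random vector on ℝ^F. Then for all x_i, x_j ∈ ℝ^F, E[σ̇(uᵀx_i)·σ̇(uᵀx_j)] = (α²/π)·( (1 + 2α²·‖x_i‖²)·(1 + 2α²·‖x_j‖²) − 4α⁴·(x_iᵀx_j)² )^{−1/2}, where σ̇ is the derivative of σ. -/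
open MeasureTheory ProbabilityTheory Filter

noncomputable section

/-- The scaled error function with scaling factor `α`:
`σ(p) = (1/√π)·∫₀^{αp} e^{−t²} dt + 1/2`. -/
def erfScaled (α : ℝ) (p : ℝ) : ℝ :=
  (1 / Real.sqrt Real.pi) * (∫ t in (0:ℝ)..(α * p), Real.exp (-(t^2))) + 1/2

lemma aux_deriv (α : ℝ) (p : ℝ) :
    deriv (erfScaled α) p = (α / Real.sqrt Real.pi) * Real.exp (-((α * p)^2)) := by
  have hc : Continuous fun t : ℝ => Real.exp (-(t^2)) := by fun_prop
  have h1 : HasDerivAt (fun y : ℝ => ∫ t in (0:ℝ)..y, Real.exp (-(t^2)))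
      (Real.exp (-((α * p)^2))) (α * p) :=
    intervalIntegral.integral_hasDerivAt_right (hc.intervalIntegrable _ _)
      hc.aestronglyMeasurable.stronglyMeasurableAtFilter hc.continuousAt
  have h2 : HasDerivAt (fun q : ℝ => α * q) α p := by
    simpa using (hasDerivAt_id p).const_mul α
  have h3 := ((h1.comp p h2).const_mul (1 / Real.sqrt Real.pi)).add_const (1/2)
  have h4 : HasDerivAt (erfScaled α)
      (1 / Real.sqrt Real.pi * (Real.exp (-((α * p)^2)) * α)) p := h3
  rw [h4.deriv]; ring

lemma aux_1d (k m : ℝ) (hk : 0 < 1 + 2 * k) :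
    ∫ z, Real.exp (-k * z^2 + m * z) ∂(gaussianReal 0 1)
      = (Real.sqrt (1 + 2 * k))⁻¹ * Real.exp (m^2 / (2 * (1 + 2 * k))) := by
  rw [integral_gaussianReal_eq_integral_smul (by norm_num)]
  have h : ∀ z : ℝ, gaussianPDFReal 0 1 z • Real.exp (-k * z^2 + m * z)
      = ((Real.sqrt (2 * Real.pi))⁻¹ * Real.exp (m^2 / (2 * (1 + 2 * k)))) *
        (fun y : ℝ => Real.exp (-((1 + 2 * k)/2) * y^2)) (z - m / (1 + 2 * k)) := by
    intro z
    simp only [gaussianPDFReal, smul_eq_mul, NNReal.coe_one, mul_one, sub_zero]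
    rw [mul_assoc, mul_assoc, ← Real.exp_add, ← Real.exp_add]
    congr 2
    field_simp
    ring
  simp_rw [h]
  rw [integral_const_mul, integral_sub_right_eq_self
    (fun y : ℝ => Real.exp (-((1 + 2 * k)/2) * y^2)), integral_gaussian]
  have : Real.pi / ((1 + 2 * k)/2) = (2 * Real.pi) / (1 + 2 * k) := by field_simp
  rw [this, Real.sqrt_div (by positivity)]
  have : Real.sqrt (2 * Real.pi) ≠ 0 := by positivity
  field_simp

lemma aux_cs {F : ℕ} (x y : Fin F → ℝ) : (dot x y)^2 ≤ dot x x * dot y y := by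
  have := Finset.sum_mul_sq_le_sq_mul_sq Finset.univ x y
  simpa [dot, sq] using this

lemma aux_nonneg {F : ℕ} (x : Fin F → ℝ) : 0 ≤ dot x x :=
  Finset.sum_nonneg fun _ _ => mul_self_nonneg _

lemma aux_2d (A B C : ℝ) (hA : 0 ≤ A) (hB : 0 ≤ B) (hC : C^2 ≤ A * B) :
    ∫ p : ℝ × ℝ, Real.exp (-(p.1^2 * A + 2 * p.1 * p.2 * C + p.2^2 * B))
        ∂((gaussianReal 0 1).prod (gaussianReal 0 1))
      = (Real.sqrt ((1 + 2 * A) * (1 + 2 * B) - 4 * C^2))⁻¹ := by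
  have hq : ∀ s t : ℝ, 0 ≤ s^2 * A + 2 * s * t * C + t^2 * B := by
    intro s t
    rcases hA.eq_or_lt with h | h
    · subst h
      have : C = 0 := by nlinarith
      subst this
      have : 0 ≤ t^2 * B := by positivity
      linarith
    · have : 0 ≤ A * (s^2 * A + 2 * s * t * C + t^2 * B) := by
        nlinarith [sq_nonneg (s * A + t * C), mul_nonneg (sq_nonneg t) (sub_nonneg.2 hC)]
      exact nonneg_of_mul_nonneg_right this h
  have hint : Integrable (fun p : ℝ × ℝ =>
      Real.exp (-(p.1^2 * A + 2 * p.1 * p.2 * C + p.2^2 * B)))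
      ((gaussianReal 0 1).prod (gaussianReal 0 1)) := by
    refine Integrable.of_bound (C := 1) (by
      apply Continuous.aestronglyMeasurable; fun_prop) (Eventually.of_forall fun p => ?_)
    rw [Real.norm_eq_abs, abs_of_pos (Real.exp_pos _)]
    exact Real.exp_le_one_iff.2 (by linarith [hq p.1 p.2])
  rw [integral_prod _ hint]
  have hB' : 0 < 1 + 2 * B := by linarith
  have hin : ∀ s : ℝ, ∫ t, Real.exp (-(s^2 * A + 2 * s * t * C + t^2 * B)) ∂(gaussianReal 0 1)
      = (Real.sqrt (1 + 2 * B))⁻¹ *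
        Real.exp (-(A - 2 * C^2 / (1 + 2 * B)) * s^2 + 0 * s) := by
    intro s
    have : ∀ t : ℝ, Real.exp (-(s^2 * A + 2 * s * t * C + t^2 * B))
        = Real.exp (-(s^2 * A)) * Real.exp (-B * t^2 + (-2 * s * C) * t) := by
      intro t; rw [← Real.exp_add]; congr 1; ring
    simp_rw [this]
    rw [integral_const_mul, aux_1d _ _ hB', mul_left_comm, ← Real.exp_add]
    congr 2
    field_simp
    ring
  simp_rw [hin]
  have hD : 0 < (1 + 2 * A) * (1 + 2 * B) - 4 * C^2 := by nlinarith
  have he : 1 + 2 * (A - 2 * C^2 / (1 + 2 * B))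
      = ((1 + 2 * A) * (1 + 2 * B) - 4 * C^2) / (1 + 2 * B) := by
    field_simp
    ring
  rw [integral_const_mul, aux_1d _ _ (by rw [he]; positivity), he, Real.sqrt_div hD.le]
  have : Real.sqrt (1 + 2 * B) ≠ 0 := by positivity
  simp
  field_simp

lemma aux_cf (t : ℝ) : ∫ z : ℝ, Complex.exp ((t * z : ℝ) * Complex.I) ∂(gaussianReal 0 1)
    = Complex.exp (-(t^2 / 2 : ℝ)) := by
  have := charFun_gaussianReal (μ := 0) (v := 1) t
  rw [charFun_apply_real] at this
  simpa using this

lemma aux_pi {F : ℕ} (w : Fin F → ℝ) :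
    ∫ u, Complex.exp ((dot u w : ℝ) * Complex.I) ∂(stdGauss F)
      = Complex.exp (-(dot w w / 2 : ℝ)) := by
  have h : ∀ u : Fin F → ℝ, Complex.exp ((dot u w : ℝ) * Complex.I)
      = ∏ k, (fun z : ℝ => Complex.exp ((w k * z : ℝ) * Complex.I)) (u k) := by
    intro u
    rw [← Complex.exp_sum, ← Finset.sum_mul, dot, Complex.ofReal_sum]
    simp_rw [mul_comm (w _)]
  simp_rw [h]
  rw [stdGauss, integral_fintype_prod_eq_prod
    (f := fun k (z : ℝ) => Complex.exp ((w k * z : ℝ) * Complex.I))]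
  simp_rw [aux_cf]
  rw [← Complex.exp_sum, Finset.sum_neg_distrib, ← Complex.ofReal_sum, dot, Finset.sum_div]
  simp_rw [sq]

instance aux_inst (F : ℕ) : IsProbabilityMeasure (stdGauss F) := by
  unfold stdGauss; infer_instance

lemma aux_main {F : ℕ} (x y : Fin F → ℝ) :
    ∫ u, Real.exp (-((dot u x)^2 / 2)) * Real.exp (-((dot u y)^2 / 2)) ∂(stdGauss F)
      = ∫ p : ℝ × ℝ, Real.exp (-(p.1^2 * (dot x x / 2) + 2 * p.1 * p.2 * (dot x y / 2)
          + p.2^2 * (dot y y / 2))) ∂((gaussianReal 0 1).prod (gaussianReal 0 1)) := by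
  have hd : ∀ (u : Fin F → ℝ) (p : ℝ × ℝ),
      dot u (fun k => p.1 * x k + p.2 * y k) = dot u x * p.1 + dot u y * p.2 := by
    intro u p
    simp only [dot, Finset.sum_mul, ← Finset.sum_add_distrib]
    exact Finset.sum_congr rfl fun _ _ => by ring
  have hw : ∀ (p : ℝ × ℝ),
      dot (fun k => p.1 * x k + p.2 * y k) (fun k => p.1 * x k + p.2 * y k) / 2
      = p.1^2 * (dot x x / 2) + 2 * p.1 * p.2 * (dot x y / 2) + p.2^2 * (dot y y / 2) := by
    intro p
    simp only [dot, Finset.sum_div, Finset.mul_sum, ← Finset.sum_add_distrib]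
    exact Finset.sum_congr rfl fun _ _ => by ring
  apply Complex.ofReal_injective
  rw [← integral_complex_ofReal, ← integral_complex_ofReal]
  have h1 : ∀ u : Fin F → ℝ,
      ((Real.exp (-((dot u x)^2 / 2)) * Real.exp (-((dot u y)^2 / 2)) : ℝ) : ℂ)
      = ∫ p : ℝ × ℝ, Complex.exp ((dot u (fun k => p.1 * x k + p.2 * y k) : ℝ) * Complex.I)
          ∂((gaussianReal 0 1).prod (gaussianReal 0 1)) := by
    intro u
    rw [Complex.ofReal_mul, Complex.ofReal_exp, Complex.ofReal_exp, Complex.ofReal_neg,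
      Complex.ofReal_neg, ← aux_cf, ← aux_cf, ← integral_prod_mul]
    congr 1
    ext p
    rw [← Complex.exp_add, hd]
    congr 1
    push_cast
    ring
  simp_rw [h1]
  rw [integral_integral_swap]
  · simp_rw [aux_pi, hw]
    push_cast
    rfl
  · refine Integrable.of_bound (C := 1) ?_ (Eventually.of_forall fun q => ?_)
    · apply Continuous.aestronglyMeasurable
      simp only [Function.uncurry_def, dot]
      fun_prop
    · simp only [Function.uncurry_def]
      rw [Complex.norm_exp_ofReal_mul_I]

/-- For the scaled error function, with `σ̇` its derivative,
`E[σ̇(uᵀx_i)·σ̇(uᵀx_j)]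
  = (α²/π)·((1 + 2α²‖x_i‖²)(1 + 2α²‖x_j‖²) − 4α⁴(x_iᵀx_j)²)^{−1/2}`. -/
theorem stmt2 (F : ℕ) (α : ℝ) (hα : 0 < α) (xi xj : Fin F → ℝ) :
    ∫ u, deriv (erfScaled α) (dot u xi) * deriv (erfScaled α) (dot u xj) ∂ stdGauss F
      = (α^2 / Real.pi) *
          ((1 + 2 * α^2 * dot xi xi) * (1 + 2 * α^2 * dot xj xj)
            - 4 * α^4 * (dot xi xj)^2) ^ (-(1/2) : ℝ) := by
  have hs : ∀ (u x : Fin F → ℝ), -((α * dot u x)^2)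
      = -((dot u (fun k => Real.sqrt 2 * α * x k))^2 / 2) := by
    intro u x
    have : dot u (fun k => Real.sqrt 2 * α * x k) = Real.sqrt 2 * α * dot u x := by
      simp only [dot, Finset.mul_sum]
      exact Finset.sum_congr rfl fun _ _ => by ring
    rw [this, mul_pow, mul_pow, mul_pow, Real.sq_sqrt (by norm_num)]
    ring
  have hdd : ∀ (x y : Fin F → ℝ),
      dot (fun k => Real.sqrt 2 * α * x k) (fun k => Real.sqrt 2 * α * y k) / 2
      = α^2 * dot x y := by
    intro x y
    have h2 : Real.sqrt 2 * Real.sqrt 2 = 2 := Real.mul_self_sqrt (by norm_num)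
    simp only [dot, Finset.mul_sum, Finset.sum_div]
    refine Finset.sum_congr rfl fun k _ => ?_
    linear_combination (α^2 * x k * y k / 2) * h2
  have hf : ∀ u : Fin F → ℝ,
      deriv (erfScaled α) (dot u xi) * deriv (erfScaled α) (dot u xj)
      = (α^2 / Real.pi) * (Real.exp (-((dot u (fun k => Real.sqrt 2 * α * xi k))^2 / 2)) *
        Real.exp (-((dot u (fun k => Real.sqrt 2 * α * xj k))^2 / 2))) := by
    intro u
    rw [aux_deriv, aux_deriv, hs, hs]
    have h2 : α^2 / Real.pi = (α / Real.sqrt Real.pi) * (α / Real.sqrt Real.pi) := by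
      rw [div_mul_div_comm, Real.mul_self_sqrt Real.pi_pos.le, sq]
    rw [h2]; ring
  simp_rw [hf]
  have hA := aux_nonneg xi
  have hB := aux_nonneg xj
  have hC := aux_cs xi xj
  have hC' : (α^2 * dot xi xj)^2 ≤ (α^2 * dot xi xi) * (α^2 * dot xj xj) := by
    have := mul_le_mul_of_nonneg_left hC (by positivity : 0 ≤ α^4)
    nlinarith
  rw [integral_const_mul, aux_main]
  simp_rw [hdd]
  rw [aux_2d _ _ _ (by positivity) (by positivity) hC']
  have he : (1 + 2 * (α^2 * dot xi xi)) * (1 + 2 * (α^2 * dot xj xj))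
      - 4 * (α^2 * dot xi xj)^2 = (1 + 2 * α^2 * dot xi xi) * (1 + 2 * α^2 * dot xj xj)
            - 4 * α^4 * (dot xi xj)^2 := by ring
  have hD : 0 ≤ (1 + 2 * α^2 * dot xi xi) * (1 + 2 * α^2 * dot xj xj)
            - 4 * α^4 * (dot xi xj)^2 := by
    rw [← he]
    have h1 : 0 ≤ α^2 * dot xi xi := by positivity
    have h2 : 0 ≤ α^2 * dot xj xj := by positivity
    nlinarith
  rw [he, Real.rpow_neg hD, Real.sqrt_eq_rpow]

end
end

section
/- Fix F ≥ 1, a decision function σ, a tree architecture with leaf-count function Q and maximal leaf depth D, and inputs x_i, x_j ∈ ℝ^F. Then the empirical NTK at the NTK initialization of an ensemble of M soft trees with this architecture, Θ̂₀^M(x_i,x_j), converges in probability as M → ∞ to the deterministic value ∑_{d=1}^{D} Q(d)·Θ^{(d,Rule)}(x_i,x_j), where Θ^{(d,Rule)}(x_i,x_j) = d·Σ(x_i,x_j)·T(x_i,x_j)^{d−1}·Ṫ(x_i,x_j) + T(x_i,x_j)^d. -/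
open MeasureTheory ProbabilityTheory Filter

noncomputable section

/-- The limiting rule-set NTK:
`Θ^{(d,Rule)}(x_i,x_j) = d·Σ(x_i,x_j)·T(x_i,x_j)^{d−1}·Ṫ(x_i,x_j) + T(x_i,x_j)^d`. -/
def thetaRule {F : ℕ} (σ : ℝ → ℝ) (d : ℕ) (xi xj : Fin F → ℝ) : ℝ :=
  (d : ℝ) * dot xi xj * (Tker σ xi xj)^(d-1) * Tdot σ xi xj + (Tker σ xi xj)^d

namespace NTKAux
open BTree

def splitFun (F : ℕ) (l r : BTree) :
    Fin F ⊕ (TParam l F ⊕ TParam r F) → TParam (BTree.node l r) F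
  | .inl k => .inl (⟨[], by simp [nodeFinset, nodePaths]⟩, k)
  | .inr (.inl (.inl (a, k))) => .inl (⟨true :: a.1, by
      have := a.2; simp only [nodeFinset, List.mem_toFinset] at this; simp [nodeFinset, nodePaths, this]⟩, k)
  | .inr (.inl (.inr a)) => .inr ⟨true :: a.1, by
      have := a.2; simp only [leafFinset, List.mem_toFinset] at this; simp [leafFinset, leafPaths, this]⟩
  | .inr (.inr (.inl (a, k))) => .inl (⟨false :: a.1, by
      have := a.2; simp only [nodeFinset, List.mem_toFinset] at this; simp [nodeFinset, nodePaths, this]⟩, k)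
  | .inr (.inr (.inr a)) => .inr ⟨false :: a.1, by
      have := a.2; simp only [leafFinset, List.mem_toFinset] at this; simp [leafFinset, leafPaths, this]⟩

lemma splitFun_bij (F : ℕ) (l r : BTree) : Function.Bijective (splitFun F l r) := by
  constructor
  · rintro (k | (⟨⟨a, ha⟩, k⟩ | ⟨a, ha⟩) | (⟨⟨a, ha⟩, k⟩ | ⟨a, ha⟩))
      (k' | (⟨⟨a', ha'⟩, k'⟩ | ⟨a', ha'⟩) | (⟨⟨a', ha'⟩, k'⟩ | ⟨a', ha'⟩)) h <;>
    simp_all [splitFun]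
  · rintro (⟨⟨a, ha⟩, k⟩ | ⟨a, ha⟩)
    · have h := ha
      simp only [nodeFinset, nodePaths, List.mem_toFinset, List.mem_cons, List.mem_append,
        List.mem_map] at h
      rcases h with rfl | ⟨b, hb, rfl⟩ | ⟨b, hb, rfl⟩
      · exact ⟨.inl k, rfl⟩
      · exact ⟨.inr (.inl (.inl (⟨b, by simpa [nodeFinset] using hb⟩, k))), rfl⟩
      · exact ⟨.inr (.inr (.inl (⟨b, by simpa [nodeFinset] using hb⟩, k))), rfl⟩
    · have h := ha
      simp only [leafFinset, leafPaths, List.mem_toFinset, List.mem_append,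
        List.mem_map] at h
      rcases h with ⟨b, hb, rfl⟩ | ⟨b, hb, rfl⟩
      · exact ⟨.inr (.inl (.inr ⟨b, by simpa [leafFinset] using hb⟩)), rfl⟩
      · exact ⟨.inr (.inr (.inr ⟨b, by simpa [leafFinset] using hb⟩)), rfl⟩

def splitEquiv (F : ℕ) (l r : BTree) :
    Fin F ⊕ (TParam l F ⊕ TParam r F) ≃ TParam (BTree.node l r) F :=
  Equiv.ofBijective _ (splitFun_bij F l r)

def comb {F : ℕ} {ι κ : Type} (σ : ℝ → ℝ) (f : (ι → ℝ) → (Fin F → ℝ) → ℝ)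
    (g : (κ → ℝ) → (Fin F → ℝ) → ℝ) (θ : Fin F ⊕ (ι ⊕ κ) → ℝ) (x : Fin F → ℝ) : ℝ :=
  σ (dot (fun k => θ (.inl k)) x) * f (fun k => θ (.inr (.inl k))) x +
    (1 - σ (dot (fun k => θ (.inl k)) x)) * g (fun k => θ (.inr (.inr k))) x

lemma treeF_node {F : ℕ} (σ : ℝ → ℝ) (l r : BTree) (θ : TParam (BTree.node l r) F → ℝ)
    (x : Fin F → ℝ) :
    treeF σ (BTree.node l r) θ x =
      comb σ (treeF σ l) (treeF σ r) (fun q => θ (splitEquiv F l r q)) x := by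
  have w0 : wOf (BTree.node l r) θ [] = fun k => θ (splitEquiv F l r (.inl k)) := by
    ext k
    have : ([] : List Bool) ∈ (BTree.node l r).nodeFinset := by simp [nodeFinset, nodePaths]
    simp only [wOf, dif_pos this]; rfl
  have w1 : ∀ a, wOf (BTree.node l r) θ (true :: a) =
      wOf l (fun k => θ (splitEquiv F l r (.inr (.inl k)))) a := by
    intro a; ext k
    have e : (true :: a) ∈ (BTree.node l r).nodeFinset ↔ a ∈ l.nodeFinset := by
      simp [nodeFinset, nodePaths]
    by_cases h : a ∈ l.nodeFinset
    · simp only [wOf, dif_pos h, dif_pos (e.2 h)]; rfl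
    · simp only [wOf, dif_neg h, dif_neg (mt e.1 h)]
  have w2 : ∀ a, wOf (BTree.node l r) θ (false :: a) =
      wOf r (fun k => θ (splitEquiv F l r (.inr (.inr k)))) a := by
    intro a; ext k
    have e : (false :: a) ∈ (BTree.node l r).nodeFinset ↔ a ∈ r.nodeFinset := by
      simp [nodeFinset, nodePaths]
    by_cases h : a ∈ r.nodeFinset
    · simp only [wOf, dif_pos h, dif_pos (e.2 h)]; rfl
    · simp only [wOf, dif_neg h, dif_neg (mt e.1 h)]
  have p1 : ∀ a, piOf (BTree.node l r) θ (true :: a) =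
      piOf l (fun k => θ (splitEquiv F l r (.inr (.inl k)))) a := by
    intro a
    have e : (true :: a) ∈ (BTree.node l r).leafFinset ↔ a ∈ l.leafFinset := by
      simp [leafFinset, leafPaths]
    by_cases h : a ∈ l.leafFinset
    · simp only [piOf, dif_pos h, dif_pos (e.2 h)]; rfl
    · simp only [piOf, dif_neg h, dif_neg (mt e.1 h)]
  have p2 : ∀ a, piOf (BTree.node l r) θ (false :: a) =
      piOf r (fun k => θ (splitEquiv F l r (.inr (.inr k)))) a := by
    intro a
    have e : (false :: a) ∈ (BTree.node l r).leafFinset ↔ a ∈ r.leafFinset := by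
      simp [leafFinset, leafPaths]
    by_cases h : a ∈ r.leafFinset
    · simp only [piOf, dif_pos h, dif_pos (e.2 h)]; rfl
    · simp only [piOf, dif_neg h, dif_neg (mt e.1 h)]
  simp only [treeF, comb, leafPaths, List.map_append, List.sum_append, List.map_map,
    Function.comp_def, pathProd, w0, w1, w2, p1, p2, ← List.sum_map_mul_left]
  congr 3
  · funext a; simp; ring
  · funext a; simp; ring

lemma pderiv_reindex {ι κ : Type} [DecidableEq ι] [DecidableEq κ] (e : ι ≃ κ)
    (g : (ι → ℝ) → ℝ) (θ : κ → ℝ) (q : ι) :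
    pderiv (fun θ' => g (fun i => θ' (e i))) θ (e q) = pderiv g (fun i => θ (e i)) q := by
  unfold pderiv
  congr 1
  funext s
  have : (fun i => Function.update θ (e q) s (e i)) = Function.update (fun i => θ (e i)) q s := by
    funext i
    simp [Function.update_apply]
  simp only [this]

lemma empNTK_reindex {ι κ : Type} [Fintype ι] [Fintype κ] [DecidableEq ι] [DecidableEq κ] {F : ℕ}
    (e : ι ≃ κ) (g : (ι → ℝ) → (Fin F → ℝ) → ℝ) (θ : κ → ℝ) (xi xj : Fin F → ℝ) :
    empNTK (fun θ' x => g (fun i => θ' (e i)) x) θ xi xj =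
      empNTK g (fun i => θ (e i)) xi xj := by
  unfold empNTK
  rw [← e.sum_comp]
  refine Finset.sum_congr rfl fun q _ => ?_
  rw [pderiv_reindex e (fun θ' => g θ' xi), pderiv_reindex e (fun θ' => g θ' xj)]

lemma pderiv_comb_inl {F : ℕ} {ι κ : Type} [DecidableEq ι] [DecidableEq κ]
    {σ : ℝ → ℝ} (hσ : Differentiable ℝ σ) (f : (ι → ℝ) → (Fin F → ℝ) → ℝ)
    (g : (κ → ℝ) → (Fin F → ℝ) → ℝ) (θ : Fin F ⊕ (ι ⊕ κ) → ℝ) (x : Fin F → ℝ) (k : Fin F) :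
    pderiv (fun θ' => comb σ f g θ' x) θ (.inl k) =
      deriv σ (dot (fun k => θ (.inl k)) x) * x k *
        (f (fun k => θ (.inr (.inl k))) x - g (fun k => θ (.inr (.inr k))) x) := by
  unfold pderiv comb
  have hd : ∀ s, dot (fun k' => Function.update θ (.inl k) s (.inl k')) x
      = dot (fun k => θ (.inl k)) x + (s - θ (.inl k)) * x k := by
    intro s
    have h1 : (fun k' => Function.update θ (.inl k) s (.inl k')) =
      Function.update (fun k => θ (.inl k)) k s := by
      funext k'; simp [Function.update_apply]
    rw [h1]
    unfold dot
    rw [← Finset.add_sum_erase _ _ (Finset.mem_univ k),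
      ← Finset.add_sum_erase Finset.univ (fun k => θ (.inl k) * x k) (Finset.mem_univ k)]
    rw [Finset.sum_congr rfl (g := fun k => θ (.inl k) * x k)]
    · simp; ring
    · intro y hy; simp [Function.update_of_ne (Finset.ne_of_mem_erase hy)]
  simp only [hd, ne_eq, reduceCtorEq, not_false_eq_true, Function.update_of_ne]
  have h2 : HasDerivAt (fun s => dot (fun k => θ (.inl k)) x + (s - θ (.inl k)) * x k)
      (x k) (θ (.inl k)) := by
    simpa using (((hasDerivAt_id (θ (.inl k))).sub_const (θ (.inl k))).mul_const (x k)).const_add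
      (dot (fun k => θ (.inl k)) x)
  have h3 : HasDerivAt (fun s => σ (dot (fun k => θ (.inl k)) x + (s - θ (.inl k)) * x k))
      (deriv σ (dot (fun k => θ (.inl k)) x) * x k) (θ (.inl k)) := by
    refine HasDerivAt.comp (θ (.inl k)) ?_ h2
    simpa using (hσ _).hasDerivAt
  refine ((h3.mul_const (f (fun k => θ (.inr (.inl k))) x)).add
    ((h3.const_sub 1).mul_const (g (fun k => θ (.inr (.inr k))) x))).deriv.trans ?_
  ring

lemma pderiv_comb_l {F : ℕ} {ι κ : Type} [DecidableEq ι] [DecidableEq κ]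
    (σ : ℝ → ℝ) (f : (ι → ℝ) → (Fin F → ℝ) → ℝ)
    (g : (κ → ℝ) → (Fin F → ℝ) → ℝ) (θ : Fin F ⊕ (ι ⊕ κ) → ℝ) (x : Fin F → ℝ) (q : ι) :
    pderiv (fun θ' => comb σ f g θ' x) θ (.inr (.inl q)) =
      σ (dot (fun k => θ (.inl k)) x) *
        pderiv (fun θ' => f θ' x) (fun k => θ (.inr (.inl k))) q := by
  unfold pderiv comb
  have h1 : ∀ s, (fun k' => Function.update θ (.inr (.inl q)) s (.inr (.inl k'))) =
      Function.update (fun k => θ (.inr (.inl k))) q s := by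
    intro s; funext k'; simp [Function.update_apply]
  simp only [h1, ne_eq, reduceCtorEq, not_false_eq_true, Function.update_of_ne, Sum.inr.injEq]
  rw [deriv_add_const, deriv_const_mul_field]

lemma pderiv_comb_r {F : ℕ} {ι κ : Type} [DecidableEq ι] [DecidableEq κ]
    (σ : ℝ → ℝ) (f : (ι → ℝ) → (Fin F → ℝ) → ℝ)
    (g : (κ → ℝ) → (Fin F → ℝ) → ℝ) (θ : Fin F ⊕ (ι ⊕ κ) → ℝ) (x : Fin F → ℝ) (q : κ) :
    pderiv (fun θ' => comb σ f g θ' x) θ (.inr (.inr q)) =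
      (1 - σ (dot (fun k => θ (.inl k)) x)) *
        pderiv (fun θ' => g θ' x) (fun k => θ (.inr (.inr k))) q := by
  unfold pderiv comb
  have h1 : ∀ s, (fun k' => Function.update θ (.inr (.inr q)) s (.inr (.inr k'))) =
      Function.update (fun k => θ (.inr (.inr k))) q s := by
    intro s; funext k'; simp [Function.update_apply]
  simp only [h1, ne_eq, reduceCtorEq, not_false_eq_true, Function.update_of_ne, Sum.inr.injEq]
  rw [deriv_const_add, deriv_const_mul_field]

lemma empNTK_comb {F : ℕ} {ι κ : Type} [Fintype ι] [Fintype κ] [DecidableEq ι] [DecidableEq κ]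
    {σ : ℝ → ℝ} (hσ : Differentiable ℝ σ) (f : (ι → ℝ) → (Fin F → ℝ) → ℝ)
    (g : (κ → ℝ) → (Fin F → ℝ) → ℝ) (θ : Fin F ⊕ (ι ⊕ κ) → ℝ) (xi xj : Fin F → ℝ) :
    empNTK (comb σ f g) θ xi xj =
      dot xi xj * (deriv σ (dot (fun k => θ (.inl k)) xi) * deriv σ (dot (fun k => θ (.inl k)) xj)) *
        ((f (fun k => θ (.inr (.inl k))) xi - g (fun k => θ (.inr (.inr k))) xi) *
         (f (fun k => θ (.inr (.inl k))) xj - g (fun k => θ (.inr (.inr k))) xj)) +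
      σ (dot (fun k => θ (.inl k)) xi) * σ (dot (fun k => θ (.inl k)) xj) *
        empNTK f (fun k => θ (.inr (.inl k))) xi xj +
      (1 - σ (dot (fun k => θ (.inl k)) xi)) * (1 - σ (dot (fun k => θ (.inl k)) xj)) *
        empNTK g (fun k => θ (.inr (.inr k))) xi xj := by
  conv_lhs => unfold empNTK
  rw [Fintype.sum_sum_type, Fintype.sum_sum_type, ← add_assoc]
  simp only [pderiv_comb_inl hσ, pderiv_comb_l, pderiv_comb_r]
  congr 1
  · congr 1
    · rw [show dot xi xj = ∑ k, xi k * xj k from rfl, Finset.sum_mul, Finset.sum_mul]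
      refine Finset.sum_congr rfl fun k _ => ?_
      ring
    · rw [empNTK, Finset.mul_sum]
      refine Finset.sum_congr rfl fun k _ => ?_
      ring
  · rw [empNTK, Finset.mul_sum]
    refine Finset.sum_congr rfl fun k _ => ?_
    ring

lemma empNTK_gen {F : ℕ} {ι κ ρ : Type} [Fintype ι] [Fintype κ] [DecidableEq ι] [DecidableEq κ]
    [Fintype ρ] [DecidableEq ρ] (e : Fin F ⊕ (ι ⊕ κ) ≃ ρ)
    {σ : ℝ → ℝ} (hσ : Differentiable ℝ σ) (f : (ι → ℝ) → (Fin F → ℝ) → ℝ)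
    (g : (κ → ℝ) → (Fin F → ℝ) → ℝ) (h : (ρ → ℝ) → (Fin F → ℝ) → ℝ)
    (hh : ∀ θ x, h θ x = comb σ f g (fun q => θ (e q)) x) (θ : ρ → ℝ) (xi xj : Fin F → ℝ) :
    empNTK h θ xi xj =
      dot xi xj * (deriv σ (dot (fun k => θ (e (.inl k))) xi) *
          deriv σ (dot (fun k => θ (e (.inl k))) xj)) *
        ((f (fun k => θ (e (.inr (.inl k)))) xi - g (fun k => θ (e (.inr (.inr k)))) xi) *
         (f (fun k => θ (e (.inr (.inl k)))) xj - g (fun k => θ (e (.inr (.inr k)))) xj)) +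
      σ (dot (fun k => θ (e (.inl k))) xi) * σ (dot (fun k => θ (e (.inl k))) xj) *
        empNTK f (fun k => θ (e (.inr (.inl k)))) xi xj +
      (1 - σ (dot (fun k => θ (e (.inl k))) xi)) * (1 - σ (dot (fun k => θ (e (.inl k))) xj)) *
        empNTK g (fun k => θ (e (.inr (.inr k)))) xi xj := by
  rw [← empNTK_comb hσ f g (fun q => θ (e q)), ← empNTK_reindex e]
  congr 1
  funext θ x
  exact hh θ x

lemma empNTK_ensemble {F : ℕ} (σ : ℝ → ℝ) (t : BTree) (M : ℕ)
    (θ : Fin M × TParam t F → ℝ) (xi xj : Fin F → ℝ) :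
    empNTK (ensembleF σ t M) θ xi xj =
      (1 / (M : ℝ)) * ∑ m : Fin M, empNTK (treeF σ t) (fun p => θ (m, p)) xi xj := by
  have key : ∀ (x : Fin F → ℝ) (m : Fin M) (q : TParam t F),
      pderiv (fun θ' => ensembleF σ t M θ' x) θ (m, q) =
        (1 / Real.sqrt M) * pderiv (fun θ' => treeF σ t θ' x) (fun p => θ (m, p)) q := by
    intro x m q
    unfold pderiv ensembleF
    rw [deriv_const_mul_field]
    congr 1
    have h1 : ∀ s, ∑ m' : Fin M, treeF σ t (fun p => Function.update θ (m, q) s (m', p)) x =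
        treeF σ t (Function.update (fun p => θ (m, p)) q s) x +
          ∑ m' ∈ Finset.univ.erase m, treeF σ t (fun p => θ (m', p)) x := by
      intro s
      rw [← Finset.add_sum_erase _ _ (Finset.mem_univ m)]
      congr 1
      · congr 1; funext p; simp [Function.update_apply]
      · refine Finset.sum_congr rfl fun m' hm' => ?_
        congr 1; funext p
        have := Finset.ne_of_mem_erase hm'
        simp [this]
    simp only [h1]
    rw [deriv_add_const]
  unfold empNTK
  rw [Fintype.sum_prod_type, Finset.mul_sum]
  refine Finset.sum_congr rfl fun m _ => ?_
  rw [Finset.mul_sum]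
  refine Finset.sum_congr rfl fun q _ => ?_
  rw [key, key]
  have : (1 / Real.sqrt M) * (1 / Real.sqrt M) = 1 / (M : ℝ) := by
    rw [div_mul_div_comm, one_mul, Real.mul_self_sqrt (Nat.cast_nonneg M)]
  rw [← this]; ring


/-- the projection to root weights, left and right parameters -/
def proj {F : ℕ} {ι κ ρ : Type} (e : Fin F ⊕ (ι ⊕ κ) ≃ ρ) (θ : ρ → ℝ) :
    (Fin F → ℝ) × ((ι → ℝ) × (κ → ℝ)) :=
  (fun k => θ (e (.inl k)), (fun k => θ (e (.inr (.inl k))), fun k => θ (e (.inr (.inr k)))))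

instance (ι : Type) [Fintype ι] : IsProbabilityMeasure (initMeasure ι) := by
  unfold initMeasure; infer_instance

instance (F : ℕ) : IsProbabilityMeasure (stdGauss F) := by
  unfold stdGauss; infer_instance

lemma mp_sum (ι κ : Type) [Fintype ι] [Fintype κ] :
    MeasurePreserving (fun θ : ι ⊕ κ → ℝ => ((fun k => θ (.inl k), fun k => θ (.inr k)) :
      (ι → ℝ) × (κ → ℝ)))
      (initMeasure (ι ⊕ κ)) ((initMeasure ι).prod (initMeasure κ)) :=
  measurePreserving_sumPiEquivProdPi (X := fun _ : ι ⊕ κ => ℝ) (fun _ => gaussianReal 0 1)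

lemma mp_reindex {ι κ : Type} [Fintype ι] [Fintype κ] (e : ι ≃ κ) :
    MeasurePreserving (fun (θ : κ → ℝ) (i : ι) => θ (e i)) (initMeasure κ) (initMeasure ι) := by
  have := (measurePreserving_piCongrLeft (α := fun _ : κ => ℝ)
    (fun _ => gaussianReal 0 1) e).symm
  exact this

lemma mp_proj {F : ℕ} {ι κ ρ : Type} [Fintype ι] [Fintype κ] [Fintype ρ]
    (e : Fin F ⊕ (ι ⊕ κ) ≃ ρ) :
    MeasurePreserving (proj e) (initMeasure ρ)
      ((stdGauss F).prod ((initMeasure ι).prod (initMeasure κ))) := by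
  have h1 := mp_reindex e
  have h2 := mp_sum (Fin F) (ι ⊕ κ)
  have h3 := mp_sum ι κ
  have h4 := (MeasurePreserving.id (initMeasure (Fin F))).prod h3
  exact h4.comp (h2.comp h1)

lemma mp_curry (M : ℕ) (κ : Type) [Fintype κ] :
    MeasurePreserving (fun (θ : Fin M × κ → ℝ) (m : Fin M) (q : κ) => θ (m, q))
      (initMeasure (Fin M × κ)) (Measure.pi fun _ : Fin M => initMeasure κ) := by
  refine ⟨by fun_prop, ?_⟩
  have := Measure.infinitePi_map_curry (ι := Fin M) (κ := κ) (X := ℝ)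
    (μ := fun _ _ => gaussianReal 0 1)
  simp only [Measure.infinitePi_eq_pi] at this
  exact this

lemma mp_neg (F : ℕ) : MeasurePreserving (fun (u : Fin F → ℝ) (k : Fin F) => - u k)
    (stdGauss F) (stdGauss F) := by
  refine measurePreserving_pi _ _ (f := fun _ x => -x) fun i => ⟨by fun_prop, ?_⟩
  simpa using gaussianReal_map_neg (μ := 0) (v := 1)

lemma T_neg {F : ℕ} {σ : ℝ → ℝ} (hσ : IsDecisionFunc σ) (xi xj : Fin F → ℝ) :
    ∫ u, (1 - σ (dot u xi)) * (1 - σ (dot u xj)) ∂ stdGauss F = Tker σ xi xj := by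
  have hd : Measurable σ := hσ.differentiable.continuous.measurable
  have hm : ∀ x : Fin F → ℝ, Measurable fun u : Fin F → ℝ => dot u x := by
    intro x; unfold dot; fun_prop
  unfold Tker
  have hp := mp_neg F
  conv_rhs => rw [← hp.map_eq]
  rw [integral_map hp.measurable.aemeasurable]
  · congr 1
    funext u
    have h : ∀ x : Fin F → ℝ, dot (fun k => - u k) x = - dot u x := by
      intro x; simp [dot]
    have hs := hσ.symm
    rw [h, h, eq_sub_of_add_eq' (hs (dot u xi)), eq_sub_of_add_eq' (hs (dot u xj))]
  · exact ((hd.comp (hm xi)).mul (hd.comp (hm xj))).aestronglyMeasurable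

lemma core {U A B : Type*} [MeasurableSpace U] [MeasurableSpace A] [MeasurableSpace B]
    {μ : Measure U} {α : Measure A} {β : Measure B} [IsProbabilityMeasure μ]
    [IsProbabilityMeasure α] [IsProbabilityMeasure β] {p q r s : U → ℝ}
    (hp : Integrable p μ) (hq : Integrable q μ) (hr : Integrable r μ) (hs : Integrable s μ)
    {A1 a a' : A → ℝ} {B1 b b' : B → ℝ} (hA1 : Integrable A1 α) (ha : Integrable a α)
    (ha' : Integrable a' α) (hB1 : Integrable B1 β) (hb : Integrable b β)
    (hb' : Integrable b' β) (ha0 : ∫ x, a x ∂α = 0) (ha'0 : ∫ x, a' x ∂α = 0) :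
    Integrable (fun z : U × (A × B) => p z.1 * A1 z.2.1 + q z.1 * B1 z.2.2 +
      r z.1 * (a z.2.1 * b z.2.2) + s z.1 * (a' z.2.1 * b' z.2.2)) (μ.prod (α.prod β)) ∧
    ∫ z : U × (A × B), p z.1 * A1 z.2.1 + q z.1 * B1 z.2.2 +
      r z.1 * (a z.2.1 * b z.2.2) + s z.1 * (a' z.2.1 * b' z.2.2) ∂(μ.prod (α.prod β)) =
      (∫ u, p u ∂μ) * (∫ x, A1 x ∂α) + (∫ u, q u ∂μ) * (∫ x, B1 x ∂β) := by
  have i1 : Integrable (fun z : U × (A × B) => p z.1 * A1 z.2.1) (μ.prod (α.prod β)) :=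
    hp.mul_prod (hA1.comp_fst β)
  have i2 : Integrable (fun z : U × (A × B) => q z.1 * B1 z.2.2) (μ.prod (α.prod β)) :=
    hq.mul_prod (hB1.comp_snd α)
  have i3 : Integrable (fun z : U × (A × B) => r z.1 * (a z.2.1 * b z.2.2)) (μ.prod (α.prod β)) :=
    hr.mul_prod (ha.mul_prod hb)
  have i4 : Integrable (fun z : U × (A × B) => s z.1 * (a' z.2.1 * b' z.2.2))
      (μ.prod (α.prod β)) := hs.mul_prod (ha'.mul_prod hb')
  have i12 : Integrable (fun z : U × (A × B) => p z.1 * A1 z.2.1 + q z.1 * B1 z.2.2)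
      (μ.prod (α.prod β)) := i1.add i2
  have i123 : Integrable (fun z : U × (A × B) => p z.1 * A1 z.2.1 + q z.1 * B1 z.2.2 +
      r z.1 * (a z.2.1 * b z.2.2)) (μ.prod (α.prod β)) := i12.add i3
  refine ⟨i123.add i4, ?_⟩
  have e1 : ∫ z : U × (A × B), p z.1 * A1 z.2.1 ∂(μ.prod (α.prod β)) =
      (∫ u, p u ∂μ) * (∫ x, A1 x ∂α) := by
    rw [integral_prod_mul p (fun y : A × B => A1 y.1), integral_fun_fst]; simp
  have e2 : ∫ z : U × (A × B), q z.1 * B1 z.2.2 ∂(μ.prod (α.prod β)) =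
      (∫ u, q u ∂μ) * (∫ x, B1 x ∂β) := by
    rw [integral_prod_mul q (fun y : A × B => B1 y.2), integral_fun_snd]; simp
  have e3 : ∫ z : U × (A × B), r z.1 * (a z.2.1 * b z.2.2) ∂(μ.prod (α.prod β)) = 0 := by
    rw [integral_prod_mul r (fun y : A × B => a y.1 * b y.2), integral_prod_mul, ha0]; simp
  have e4 : ∫ z : U × (A × B), s z.1 * (a' z.2.1 * b' z.2.2) ∂(μ.prod (α.prod β)) = 0 := by
    rw [integral_prod_mul s (fun y : A × B => a' y.1 * b' y.2), integral_prod_mul, ha'0]; simp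
  rw [integral_add i123 i4, integral_add i12 i3, integral_add i1 i2,
    e1, e2, e3, e4]
  ring

lemma memLp_bdd {Ω : Type*} [MeasurableSpace Ω] {μ : Measure Ω} [IsProbabilityMeasure μ]
    {p : ENNReal} {f g : Ω → ℝ} (hf : MemLp f p μ) (hg : Measurable g) (C : ℝ)
    (hC : ∀ x, |g x| ≤ C) : MemLp (fun x => g x * f x) p μ :=
  hf.mul' (p := ⊤) (MemLp.of_bound hg.aestronglyMeasurable C (ae_of_all _ hC))

lemma memLp_44 {Ω : Type*} [MeasurableSpace Ω] {μ : Measure Ω}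
    {f g : Ω → ℝ} (hf : MemLp f 4 μ) (hg : MemLp g 4 μ) : MemLp (fun x => f x * g x) 2 μ := by
  have : ENNReal.HolderTriple 4 4 2 := ⟨by
    rw [show (4 : ENNReal) = 2 * 2 by norm_num, ENNReal.mul_inv (by simp) (by simp), ← mul_add,
      ENNReal.inv_two_add_inv_two, mul_one]⟩
  exact hg.mul' hf

structure Good {F : ℕ} (σ : ℝ → ℝ) (xi xj : Fin F → ℝ) {ι : Type} [Fintype ι] [DecidableEq ι]
    (f : (ι → ℝ) → (Fin F → ℝ) → ℝ) (K H : ℝ) : Prop where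
  mi : MemLp (fun θ => f θ xi) 4 (initMeasure ι)
  mj : MemLp (fun θ => f θ xj) 4 (initMeasure ι)
  zi : ∫ θ, f θ xi ∂initMeasure ι = 0
  zj : ∫ θ, f θ xj ∂initMeasure ι = 0
  k : ∫ θ, f θ xi * f θ xj ∂initMeasure ι = K
  hm : MemLp (fun θ => empNTK f θ xi xj) 2 (initMeasure ι)
  h : ∫ θ, empNTK f θ xi xj ∂initMeasure ι = H

lemma core' {Ω U A B : Type*} [MeasurableSpace Ω] [MeasurableSpace U] [MeasurableSpace A]
    [MeasurableSpace B] {P : Measure Ω}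
    {μ : Measure U} {α : Measure A} {β : Measure B} [IsProbabilityMeasure μ]
    [IsProbabilityMeasure α] [IsProbabilityMeasure β] {π : Ω → U × (A × B)}
    (hπ : MeasurePreserving π P (μ.prod (α.prod β))) {p q r s : U → ℝ}
    (hp : Integrable p μ) (hq : Integrable q μ) (hr : Integrable r μ) (hs : Integrable s μ)
    {A1 a a' : A → ℝ} {B1 b b' : B → ℝ} (hA1 : Integrable A1 α) (ha : Integrable a α)
    (ha' : Integrable a' α) (hB1 : Integrable B1 β) (hb : Integrable b β)
    (hb' : Integrable b' β) (ha0 : ∫ x, a x ∂α = 0) (ha'0 : ∫ x, a' x ∂α = 0) :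
    Integrable (fun ω => p (π ω).1 * A1 (π ω).2.1 + q (π ω).1 * B1 (π ω).2.2 +
      r (π ω).1 * (a (π ω).2.1 * b (π ω).2.2) + s (π ω).1 * (a' (π ω).2.1 * b' (π ω).2.2)) P ∧
    ∫ ω, p (π ω).1 * A1 (π ω).2.1 + q (π ω).1 * B1 (π ω).2.2 +
      r (π ω).1 * (a (π ω).2.1 * b (π ω).2.2) + s (π ω).1 * (a' (π ω).2.1 * b' (π ω).2.2) ∂P =
      (∫ u, p u ∂μ) * (∫ x, A1 x ∂α) + (∫ u, q u ∂μ) * (∫ x, B1 x ∂β) := by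
  obtain ⟨h1, h2⟩ := core hp hq hr hs hA1 ha ha' hB1 hb hb' ha0 ha'0
  refine ⟨hπ.integrable_comp_of_integrable h1, ?_⟩
  rw [← h2, ← hπ.map_eq, integral_map hπ.measurable.aemeasurable]
  rw [hπ.map_eq]
  exact h1.aestronglyMeasurable

lemma good_node {F : ℕ} {σ : ℝ → ℝ} (hσ : IsDecisionFunc σ) (xi xj : Fin F → ℝ)
    {ι κ ρ : Type} [Fintype ι] [Fintype κ] [DecidableEq ι] [DecidableEq κ]
    [Fintype ρ] [DecidableEq ρ] (e : Fin F ⊕ (ι ⊕ κ) ≃ ρ)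
    (f : (ι → ℝ) → (Fin F → ℝ) → ℝ)
    (g : (κ → ℝ) → (Fin F → ℝ) → ℝ) (h : (ρ → ℝ) → (Fin F → ℝ) → ℝ)
    (hh : ∀ θ x, h θ x = comb σ f g (fun q => θ (e q)) x) {Kf Kg Hf Hg : ℝ}
    (Gf : Good σ xi xj f Kf Hf) (Gg : Good σ xi xj g Kg Hg) :
    Good σ xi xj h (Tker σ xi xj * (Kf + Kg))
      (dot xi xj * Tdot σ xi xj * (Kf + Kg) + Tker σ xi xj * (Hf + Hg)) := by
  have hsm : Measurable σ := hσ.differentiable.continuous.measurable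
  have hsd : Measurable (deriv σ) := measurable_deriv σ
  obtain ⟨C, hC⟩ := hσ.deriv_bounded
  have hdm : ∀ x : Fin F → ℝ, Measurable fun u : Fin F → ℝ => dot u x := by
    intro x; unfold dot; fun_prop
  have b1 : ∀ p, |σ p| ≤ 1 := fun p => by
    have := hσ.mem_Icc p; rw [abs_le]; constructor <;> linarith [this.1, this.2]
  have b2 : ∀ p, |1 - σ p| ≤ 1 := fun p => by
    have := hσ.mem_Icc p; rw [abs_le]; constructor <;> linarith [this.1, this.2]
  have hC0 : 0 ≤ C := (abs_nonneg _).trans (hC 0)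
  have sm : ∀ x : Fin F → ℝ, Measurable fun u : Fin F → ℝ => σ (dot u x) :=
    fun x => hsm.comp (hdm x)
  have sm' : ∀ x : Fin F → ℝ, Measurable fun u : Fin F → ℝ => 1 - σ (dot u x) :=
    fun x => measurable_const.sub (sm x)
  have dm : ∀ x : Fin F → ℝ, Measurable fun u : Fin F → ℝ => deriv σ (dot u x) :=
    fun x => hsd.comp (hdm x)
  have hbi : ∀ {φ : (Fin F → ℝ) → ℝ} (c : ℝ), Measurable φ → (∀ u, |φ u| ≤ c) →
      Integrable φ (stdGauss F) := fun c h1 h2 =>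
    Integrable.of_bound h1.aestronglyMeasurable c (ae_of_all _ h2)
  have mulb : ∀ {a b c d : ℝ}, |a| ≤ c → |b| ≤ d → |a * b| ≤ c * d := fun h1 h2 => by
    rw [abs_mul]; exact mul_le_mul h1 h2 (abs_nonneg _) ((abs_nonneg _).trans h1)
  have hπ := mp_proj e
  have mp1 : MeasurePreserving (fun θ => (proj e θ).1) (initMeasure ρ) (stdGauss F) :=
    measurePreserving_fst.comp hπ
  have mp2 : MeasurePreserving (fun θ => (proj e θ).2.1) (initMeasure ρ) (initMeasure ι) :=
    (measurePreserving_fst.comp measurePreserving_snd).comp hπ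
  have mp3 : MeasurePreserving (fun θ => (proj e θ).2.2) (initMeasure ρ) (initMeasure κ) :=
    (measurePreserving_snd.comp measurePreserving_snd).comp hπ
  have hf : ∀ θ x, h θ x = σ (dot (proj e θ).1 x) * f (proj e θ).2.1 x +
      (1 - σ (dot (proj e θ).1 x)) * g (proj e θ).2.2 x := hh
  have hH : ∀ θ, empNTK h θ xi xj =
      dot xi xj * (deriv σ (dot (proj e θ).1 xi) * deriv σ (dot (proj e θ).1 xj)) *
        ((f (proj e θ).2.1 xi - g (proj e θ).2.2 xi) *
         (f (proj e θ).2.1 xj - g (proj e θ).2.2 xj)) +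
      σ (dot (proj e θ).1 xi) * σ (dot (proj e θ).1 xj) * empNTK f (proj e θ).2.1 xi xj +
      (1 - σ (dot (proj e θ).1 xi)) * (1 - σ (dot (proj e θ).1 xj)) *
        empNTK g (proj e θ).2.2 xi xj :=
    fun θ => empNTK_gen e hσ.differentiable f g h hh θ xi xj
  have fi := Gf.mi.comp_measurePreserving mp2
  have fj := Gf.mj.comp_measurePreserving mp2
  have gi := Gg.mi.comp_measurePreserving mp3
  have gj := Gg.mj.comp_measurePreserving mp3
  have fh := Gf.hm.comp_measurePreserving mp2
  have gh := Gg.hm.comp_measurePreserving mp3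
  have ifi : Integrable (fun θ => f θ xi) (initMeasure ι) := Gf.mi.integrable (by norm_num)
  have ifj : Integrable (fun θ => f θ xj) (initMeasure ι) := Gf.mj.integrable (by norm_num)
  have igi : Integrable (fun θ => g θ xi) (initMeasure κ) := Gg.mi.integrable (by norm_num)
  have igj : Integrable (fun θ => g θ xj) (initMeasure κ) := Gg.mj.integrable (by norm_num)
  have iff : Integrable (fun θ => f θ xi * f θ xj) (initMeasure ι) :=
    (memLp_44 Gf.mi Gf.mj).integrable (by norm_num)
  have igg : Integrable (fun θ => g θ xi * g θ xj) (initMeasure κ) :=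
    (memLp_44 Gg.mi Gg.mj).integrable (by norm_num)
  have ifh : Integrable (fun θ => empNTK f θ xi xj) (initMeasure ι) :=
    Gf.hm.integrable (by norm_num)
  have igh : Integrable (fun θ => empNTK g θ xi xj) (initMeasure κ) :=
    Gg.hm.integrable (by norm_num)
  have i0 : Integrable (fun _ : Fin F → ℝ => (0:ℝ)) (stdGauss F) := integrable_zero _ _ _
  have is : ∀ x, Integrable (fun u => σ (dot u x)) (stdGauss F) := fun x =>
    hbi 1 (sm x) fun u => b1 _
  have is' : ∀ x, Integrable (fun u => 1 - σ (dot u x)) (stdGauss F) := fun x =>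
    hbi 1 (sm' x) fun u => b2 _
  have iss : Integrable (fun u => σ (dot u xi) * σ (dot u xj)) (stdGauss F) :=
    hbi (1 * 1) ((sm xi).mul (sm xj)) fun u => mulb (b1 _) (b1 _)
  have iss' : Integrable (fun u => σ (dot u xi) * (1 - σ (dot u xj))) (stdGauss F) :=
    hbi (1 * 1) ((sm xi).mul (sm' xj)) fun u => mulb (b1 _) (b2 _)
  have is's : Integrable (fun u => (1 - σ (dot u xi)) * σ (dot u xj)) (stdGauss F) :=
    hbi (1 * 1) ((sm' xi).mul (sm xj)) fun u => mulb (b2 _) (b1 _)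
  have is's' : Integrable (fun u => (1 - σ (dot u xi)) * (1 - σ (dot u xj))) (stdGauss F) :=
    hbi (1 * 1) ((sm' xi).mul (sm' xj)) fun u => mulb (b2 _) (b2 _)
  have idd : Integrable (fun u => deriv σ (dot u xi) * deriv σ (dot u xj)) (stdGauss F) :=
    hbi (C * C) ((dm xi).mul (dm xj)) fun u => mulb (hC _) (hC _)
  have mF : ∀ x, MemLp (fun θ => f (proj e θ).2.1 x) 4 (initMeasure ρ) →
      MemLp (fun θ => g (proj e θ).2.2 x) 4 (initMeasure ρ) →
      MemLp (fun θ => h θ x) 4 (initMeasure ρ) := by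
    intro x h1 h2
    simp only [hf]
    exact (memLp_bdd h1 ((sm x).comp mp1.measurable) 1 fun u => b1 _).add
      (memLp_bdd h2 ((sm' x).comp mp1.measurable) 1 fun u => b2 _)
  have zF : ∀ x, Integrable (fun θ => f θ x) (initMeasure ι) →
      Integrable (fun θ => g θ x) (initMeasure κ) → ∫ θ, f θ x ∂initMeasure ι = 0 →
      ∫ θ, g θ x ∂initMeasure κ = 0 → ∫ θ, h θ x ∂initMeasure ρ = 0 := by
    intro x h1 h2 h3 h4
    have := (core' hπ (is x) (is' x) i0 i0 h1 ifi ifi h2 igi igi Gf.zi Gf.zi).2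
    simp only [zero_mul, add_zero, h3, h4, mul_zero] at this
    simp only [hf]
    exact this
  refine ⟨mF xi fi gi, mF xj fj gj, zF xi ifi igi Gf.zi Gg.zi, zF xj ifj igj Gf.zj Gg.zj,
    ?_, ?_, ?_⟩
  · have := (core' hπ iss is's' iss' is's iff ifi ifj igg igj igi Gf.zi Gf.zj).2
    rw [T_neg hσ, Gf.k, Gg.k, ← Tker, ← mul_add] at this
    rw [← this]
    congr 1
    funext θ
    rw [hf, hf]
    ring
  · simp only [hH]
    refine (MemLp.add (memLp_bdd (memLp_44 (fi.sub gi) (fj.sub gj)) ?_ (|dot xi xj| * (C * C)) ?_)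
      (memLp_bdd fh ?_ (1 * 1) ?_)).add (memLp_bdd gh ?_ (1 * 1) ?_)
    · exact measurable_const.mul (((dm xi).comp mp1.measurable).mul ((dm xj).comp mp1.measurable))
    · exact fun θ => mulb le_rfl (mulb (hC _) (hC _))
    · exact ((sm xi).comp mp1.measurable).mul ((sm xj).comp mp1.measurable)
    · exact fun θ => mulb (b1 _) (b1 _)
    · exact ((sm' xi).comp mp1.measurable).mul ((sm' xj).comp mp1.measurable)
    · exact fun θ => mulb (b2 _) (b2 _)
  · obtain ⟨I1, E1⟩ := core' hπ (idd.const_mul (dot xi xj)) (idd.const_mul (dot xi xj))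
      (idd.const_mul (-dot xi xj)) (idd.const_mul (-dot xi xj)) iff ifi ifj igg igj igi Gf.zi Gf.zj
    obtain ⟨I2, E2⟩ := core' hπ iss is's' i0 i0 ifh ifi ifi igh igi igi Gf.zi Gf.zi
    rw [integral_const_mul, Gf.k, Gg.k, ← Tdot] at E1
    rw [T_neg hσ, Gf.h, Gg.h, ← Tker] at E2
    rw [mul_add, mul_add, ← E1, ← E2, ← integral_add I1 I2]
    congr 1
    funext θ
    rw [hH]
    ring

lemma rule_succ {F : ℕ} (σ : ℝ → ℝ) (d : ℕ) (xi xj : Fin F → ℝ) :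
    thetaRule σ (d + 1) xi xj = dot xi xj * Tdot σ xi xj * (Tker σ xi xj) ^ d +
      Tker σ xi xj * thetaRule σ d xi xj := by
  unfold thetaRule
  cases d with
  | zero => simp; 
  | succ n => simp only [Nat.add_sub_cancel]; push_cast; ring

lemma good_leaf {F : ℕ} (σ : ℝ → ℝ) (xi xj : Fin F → ℝ) :
    Good σ xi xj (treeF (F := F) σ BTree.leaf) 1 1 := by
  let q0 : TParam BTree.leaf F := .inr ⟨[], by simp [leafFinset, leafPaths]⟩
  have hf : ∀ (θ : TParam BTree.leaf F → ℝ) x, treeF σ BTree.leaf θ x = θ q0 := by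
    intro θ x
    simp [treeF, leafPaths, piOf, pathProd, leafFinset, q0]
  have hq : ∀ q : TParam BTree.leaf F, q = q0 := by
    rintro (⟨⟨a, ha⟩, k⟩ | ⟨a, ha⟩)
    · simp [nodeFinset, nodePaths] at ha
    · have h : a = [] := by simpa [leafFinset, leafPaths] using ha
      subst h; rfl
  have hmp : MeasurePreserving (fun θ : TParam BTree.leaf F → ℝ => θ q0)
      (initMeasure _) (gaussianReal 0 1) := measurePreserving_eval _ q0
  have hH : ∀ θ : TParam BTree.leaf F → ℝ, empNTK (treeF σ BTree.leaf) θ xi xj = 1 := by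
    intro θ
    have hp : ∀ x : Fin F → ℝ, pderiv (fun θ' => treeF σ BTree.leaf θ' x) θ q0 = 1 := by
      intro x; simp [pderiv, hf]
    unfold empNTK
    rw [Finset.sum_eq_single q0 (fun b _ hb => absurd (hq b) hb) (by simp), hp, hp]
    simp
  have hm : ∀ φ : ℝ → ℝ, Measurable φ → ∫ θ : TParam BTree.leaf F → ℝ, φ (θ q0) ∂initMeasure _ =
      ∫ x, φ x ∂gaussianReal 0 1 := by
    intro φ hφ
    rw [← hmp.map_eq, integral_map hmp.measurable.aemeasurable]
    exact hφ.aestronglyMeasurable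
  have h4 : MemLp (fun θ : TParam BTree.leaf F → ℝ => θ q0) 4 (initMeasure _) :=
    (memLp_id_gaussianReal' 4 (by simp)).comp_measurePreserving hmp
  have hz : ∫ θ : TParam BTree.leaf F → ℝ, θ q0 ∂initMeasure _ = 0 := by
    rw [hm (fun x => x) measurable_id, integral_id_gaussianReal]
  refine ⟨?_, ?_, ?_, ?_, ?_, ?_, ?_⟩
  · simpa only [hf] using h4
  · simpa only [hf] using h4
  · simpa only [hf] using hz
  · simpa only [hf] using hz
  · simp only [hf]
    rw [hm (fun x => x * x) (by fun_prop)]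
    have h := variance_id_gaussianReal (μ := 0) (v := 1)
    rw [variance_of_integral_eq_zero aemeasurable_id (by simp [integral_id_gaussianReal])] at h
    simpa [pow_two] using h
  · simp only [hH]; exact memLp_const _
  · simp [hH]

lemma good_tree {F : ℕ} {σ : ℝ → ℝ} (hσ : IsDecisionFunc σ) (xi xj : Fin F → ℝ) (t : BTree) :
    Good σ xi xj (treeF (F := F) σ t)
      (t.leafPaths.map fun p => Tker σ xi xj ^ p.length).sum
      (t.leafPaths.map fun p => thetaRule σ p.length xi xj).sum := by
  induction t with
  | leaf => simpa [leafPaths, thetaRule] using good_leaf σ xi xj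
  | node l r hl hr =>
    have := good_node hσ xi xj (splitEquiv F l r) _ _ _ (treeF_node σ l r) hl hr
    convert this using 1
    · simp only [leafPaths, List.map_append, List.sum_append, List.map_map,
        Function.comp_def, List.length_cons, pow_succ', List.sum_map_mul_left, mul_add]
    · simp only [leafPaths, List.map_append, List.sum_append, List.map_map,
        Function.comp_def, List.length_cons, rule_succ, List.sum_map_mul_left, mul_add,
        List.sum_map_add]
      ring

lemma len_bd (t : BTree) : ∀ p ∈ t.leafPaths, p.length ≤ t.depth := by
  induction t with
  | leaf => simp [leafPaths]
  | node l r hl hr =>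
    intro p hp
    simp only [leafPaths, List.mem_append, List.mem_map] at hp
    rcases hp with ⟨q, hq, rfl⟩ | ⟨q, hq, rfl⟩
    · have := hl q hq; simp [depth]; omega
    · have := hr q hq; simp [depth]; omega

lemma len_pos (t : BTree) (ht : t ≠ BTree.leaf) : ∀ p ∈ t.leafPaths, 1 ≤ p.length := by
  cases t with
  | leaf => exact absurd rfl ht
  | node l r =>
    intro p hp
    simp only [leafPaths, List.mem_append, List.mem_map] at hp
    rcases hp with ⟨q, hq, rfl⟩ | ⟨q, hq, rfl⟩ <;> simp

lemma list_count (φ : ℕ → ℝ) (S : Finset ℕ) (L : List (List Bool)) (hL : ∀ p ∈ L, p.length ∈ S) :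
    (L.map fun p => φ p.length).sum =
      ∑ d ∈ S, ((L.filter fun p => p.length = d).length : ℝ) * φ d := by
  induction L with
  | nil => simp
  | cons a L ih =>
    have h1 := ih fun p hp => hL p (List.mem_cons_of_mem _ hp)
    have h2 := hL a List.mem_cons_self
    rw [List.map_cons, List.sum_cons, h1]
    have : ∀ d, (((a :: L).filter fun p => p.length = d).length : ℝ) * φ d =
        (if a.length = d then φ d else 0) +
        ((L.filter fun p => p.length = d).length : ℝ) * φ d := by
      intro d
      by_cases h : a.length = d
      · simp [List.filter_cons, h]; ring
      · simp [List.filter_cons, h]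
    simp only [this, Finset.sum_add_distrib]
    congr 1
    simp [h2]

lemma wlln {κ : Type} [Fintype κ] {h : (κ → ℝ) → ℝ} (hm : MemLp h 2 (initMeasure κ)) {H : ℝ}
    (hH : ∫ θ, h θ ∂initMeasure κ = H) (ε : ℝ) (hε : 0 < ε) :
    Tendsto (fun M : ℕ => initMeasure (Fin M × κ)
      {θ | ε ≤ |(1 / (M : ℝ)) * ∑ m : Fin M, h (fun p => θ (m, p)) - H|}) atTop (nhds 0) := by
  have hlim : Tendsto (fun M : ℕ => ENNReal.ofReal ((Var[h; initMeasure κ] / ε ^ 2) / (M : ℝ)))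
      atTop (nhds 0) := by
    rw [← ENNReal.ofReal_zero]
    exact ENNReal.tendsto_ofReal (tendsto_const_div_atTop_nhds_zero_nat _)
  refine tendsto_of_tendsto_of_tendsto_of_le_of_le' tendsto_const_nhds hlim
    (Eventually.of_forall fun _ => zero_le) ?_
  filter_upwards [eventually_gt_atTop 0] with M hM
  have hM' : (M : ℝ) ≠ 0 := by positivity
  set P := Measure.pi fun _ : Fin M => initMeasure κ
  let X : (Fin M → κ → ℝ) → ℝ := fun ω => (1 / (M : ℝ)) * (∑ m : Fin M, fun ω : Fin M → κ → ℝ => h (ω m)) ω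
  have hmi : ∀ m : Fin M, MemLp (fun ω : Fin M → κ → ℝ => h (ω m)) 2 P := fun m =>
    hm.comp_measurePreserving (measurePreserving_eval _ m)
  have hXm : MemLp X 2 P := (memLp_finset_sum' _ fun m _ => hmi m).const_mul _
  have hXi : ∫ ω, X ω ∂P = H := by
    simp only [X, Finset.sum_apply]
    rw [integral_const_mul, integral_finset_sum _ fun m _ => (hmi m).integrable (by norm_num)]
    have : ∀ m : Fin M, ∫ ω, h (ω m) ∂P = H := by
      intro m
      have hp : MeasurePreserving (fun ω : Fin M → κ → ℝ => ω m) P (initMeasure κ) :=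
        measurePreserving_eval _ m
      rw [← hH, ← hp.map_eq, integral_map hp.measurable.aemeasurable]
      rw [hp.map_eq]; exact hm.aestronglyMeasurable
    simp [this]
    field_simp
  have hXv : Var[X; P] = Var[h; initMeasure κ] / M := by
    simp only [X]
    rw [variance_const_mul, variance_sum_pi (X := fun _ => h) fun _ => hm]
    simp
    field_simp
  have hc := meas_ge_le_variance_div_sq hXm hε
  rw [hXi, hXv] at hc
  have hmp := mp_curry M κ
  have hns : NullMeasurableSet {ω | ε ≤ |X ω - H|} P := by
    refine nullMeasurableSet_le aemeasurable_const ?_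
    have := hXm.aestronglyMeasurable.aemeasurable
    exact (this.sub_const H).abs
  have := hmp.measure_preimage hns
  rw [← this] at hc
  rw [div_right_comm]
  refine le_trans (le_of_eq ?_) hc
  congr 1
  ext θ
  simp [X]

end NTKAux

/-- For any tree architecture `t` (with at least one internal node), the empirical NTK at
the NTK initialization of an ensemble of `M` soft trees of architecture `t` converges in
probability, as `M → ∞`, to `∑_{d=1}^{D} Q(d)·Θ^{(d,Rule)}(x_i,x_j)` where `Q` is the
leaf-count function and `D` the maximal leaf depth of `t`. -/
theorem stmt6 (F : ℕ) (hF : 1 ≤ F) (σ : ℝ → ℝ) (hσ : IsDecisionFunc σ)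
    (t : BTree) (ht : t ≠ BTree.leaf) (xi xj : Fin F → ℝ) :
    ∀ ε > (0:ℝ), Tendsto
      (fun M : ℕ => initMeasure (Fin M × TParam t F)
        {θ | ε ≤ |empNTK (ensembleF σ t M) θ xi xj -
          ∑ d ∈ Finset.Icc 1 t.depth, (t.Q d : ℝ) * thetaRule σ d xi xj|})
      atTop (nhds 0) := by
  intro ε hε
  have G := NTKAux.good_tree hσ xi xj t
  have hs := NTKAux.list_count (fun d => thetaRule σ d xi xj) (Finset.Icc 1 t.depth) t.leafPaths
    fun p hp => Finset.mem_Icc.2 ⟨NTKAux.len_pos t ht p hp, NTKAux.len_bd t p hp⟩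
  have W := NTKAux.wlln G.hm (G.h.trans hs) ε hε
  simp only [NTKAux.empNTK_ensemble]
  exact W

end
end

section
/- Let σ be a decision function and let A and B be two tree architectures (possibly non-isomorphic as trees) whose leaf-count functions coincide: Q_A(d) = Q_B(d) for every depth d. Then for all inputs x_i, x_j ∈ ℝ^F, the empirical NTKs at the NTK initialization of an ensemble of M soft trees of architecture A and of an ensemble of M soft trees of architecture B converge in probability, as M → ∞, to the same deterministic limit. -/
open MeasureTheory ProbabilityTheory Filter

noncomputable section

namespace SoftTree

theorem mem_nodeFinset_left {l r : BTree} {a : List Bool} :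
    (true :: a) ∈ (BTree.node l r).nodeFinset ↔ a ∈ l.nodeFinset := by
  simp [BTree.nodeFinset, BTree.nodePaths]

theorem mem_nodeFinset_right {l r : BTree} {a : List Bool} :
    (false :: a) ∈ (BTree.node l r).nodeFinset ↔ a ∈ r.nodeFinset := by
  simp [BTree.nodeFinset, BTree.nodePaths]

theorem mem_nodeFinset_nil {l r : BTree} :
    [] ∈ (BTree.node l r).nodeFinset := by
  simp [BTree.nodeFinset, BTree.nodePaths]

theorem mem_leafFinset_left {l r : BTree} {a : List Bool} :
    (true :: a) ∈ (BTree.node l r).leafFinset ↔ a ∈ l.leafFinset := by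
  simp [BTree.leafFinset, BTree.leafPaths]

theorem mem_leafFinset_right {l r : BTree} {a : List Bool} :
    (false :: a) ∈ (BTree.node l r).leafFinset ↔ a ∈ r.leafFinset := by
  simp [BTree.leafFinset, BTree.leafPaths]

theorem nil_notMem_leafFinset {l r : BTree} :
    [] ∉ (BTree.node l r).leafFinset := by
  simp [BTree.leafFinset, BTree.leafPaths]

/-- index of a root weight -/
def eRoot (l r : BTree) {F : ℕ} (k : Fin F) : TParam (.node l r) F :=
  Sum.inl (⟨[], mem_nodeFinset_nil⟩, k)

def eL (l r : BTree) {F : ℕ} : TParam l F → TParam (.node l r) F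
  | .inl (⟨a, h⟩, k) => Sum.inl (⟨true :: a, mem_nodeFinset_left.2 h⟩, k)
  | .inr ⟨a, h⟩ => Sum.inr ⟨true :: a, mem_leafFinset_left.2 h⟩

def eR (l r : BTree) {F : ℕ} : TParam r F → TParam (.node l r) F
  | .inl (⟨a, h⟩, k) => Sum.inl (⟨false :: a, mem_nodeFinset_right.2 h⟩, k)
  | .inr ⟨a, h⟩ => Sum.inr ⟨false :: a, mem_leafFinset_right.2 h⟩

def eAll (l r : BTree) (F : ℕ) : Fin F ⊕ (TParam l F ⊕ TParam r F) → TParam (.node l r) F :=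
  Sum.elim (eRoot l r) (Sum.elim (eL l r) (eR l r))

theorem eAll_inj (l r : BTree) (F : ℕ) : Function.Injective (eAll l r F) := by
  rintro (a | (⟨⟨a, ha⟩, k⟩ | ⟨a, ha⟩) | (⟨⟨a, ha⟩, k⟩ | ⟨a, ha⟩))
    (b | (⟨⟨b, hb⟩, m⟩ | ⟨b, hb⟩) | (⟨⟨b, hb⟩, m⟩ | ⟨b, hb⟩)) h <;>
  simp_all [eAll, eRoot, eL, eR]

theorem eAll_surj (l r : BTree) (F : ℕ) : Function.Surjective (eAll l r F) := by
  rintro (⟨⟨a, ha⟩, k⟩ | ⟨a, ha⟩)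
  · rcases a with _ | ⟨b, a⟩
    · exact ⟨.inl k, rfl⟩
    · cases b
      · exact ⟨.inr (.inr (.inl (⟨a, mem_nodeFinset_right.1 ha⟩, k))), rfl⟩
      · exact ⟨.inr (.inl (.inl (⟨a, mem_nodeFinset_left.1 ha⟩, k))), rfl⟩
  · rcases a with _ | ⟨b, a⟩
    · exact absurd ha nil_notMem_leafFinset
    · cases b
      · exact ⟨.inr (.inr (.inr ⟨a, mem_leafFinset_right.1 ha⟩)), rfl⟩
      · exact ⟨.inr (.inl (.inr ⟨a, mem_leafFinset_left.1 ha⟩)), rfl⟩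

def eEquiv (l r : BTree) (F : ℕ) : Fin F ⊕ (TParam l F ⊕ TParam r F) ≃ TParam (.node l r) F :=
  Equiv.ofBijective (eAll l r F) ⟨eAll_inj l r F, eAll_surj l r F⟩

theorem wOf_left (l r : BTree) {F : ℕ} (θ : TParam (.node l r) F → ℝ) (a : List Bool) :
    wOf (.node l r) θ (true :: a) = wOf l (fun p => θ (eL l r p)) a := by
  funext k
  simp only [wOf, mem_nodeFinset_left, eL]

theorem wOf_right (l r : BTree) {F : ℕ} (θ : TParam (.node l r) F → ℝ) (a : List Bool) :
    wOf (.node l r) θ (false :: a) = wOf r (fun p => θ (eR l r p)) a := by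
  funext k
  simp only [wOf, mem_nodeFinset_right, eR]

theorem wOf_nil (l r : BTree) {F : ℕ} (θ : TParam (.node l r) F → ℝ) :
    wOf (.node l r) θ [] = fun k => θ (eRoot l r k) := by
  funext k
  simp only [wOf, mem_nodeFinset_nil, eRoot, dite_true]

theorem piOf_left (l r : BTree) {F : ℕ} (θ : TParam (.node l r) F → ℝ) (a : List Bool) :
    piOf (.node l r) θ (true :: a) = piOf l (fun p => θ (eL l r p)) a := by
  simp only [piOf, mem_leafFinset_left, eL]

theorem piOf_right (l r : BTree) {F : ℕ} (θ : TParam (.node l r) F → ℝ) (a : List Bool) :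
    piOf (.node l r) θ (false :: a) = piOf r (fun p => θ (eR l r p)) a := by
  simp only [piOf, mem_leafFinset_right, eR]

theorem treeF_node {F : ℕ} (σ : ℝ → ℝ) (l r : BTree) (θ : TParam (.node l r) F → ℝ)
    (x : Fin F → ℝ) :
    treeF σ (.node l r) θ x =
      σ (dot (fun k => θ (eRoot l r k)) x) * treeF σ l (fun p => θ (eL l r p)) x +
      (1 - σ (dot (fun k => θ (eRoot l r k)) x)) * treeF σ r (fun p => θ (eR l r p)) x := by
  simp only [treeF, BTree.leafPaths, List.map_append, List.sum_append, List.map_map]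
  rw [← List.sum_map_mul_left, ← List.sum_map_mul_left]
  congr 2
  · apply List.map_congr_left
    intro a _
    simp only [Function.comp, pathProd, piOf_left, wOf_left, wOf_nil]
    simp
    ring
  · apply List.map_congr_left
    intro a _
    simp only [Function.comp, pathProd, piOf_right, wOf_right, wOf_nil]
    simp
    ring

/-- The NTK of a single tree. -/
def K {F : ℕ} (σ : ℝ → ℝ) (t : BTree) (xi xj : Fin F → ℝ) (θ : TParam t F → ℝ) : ℝ :=
  empNTK (treeF σ t) θ xi xj

theorem update_comp_inj {ι κ : Type} [DecidableEq ι] [DecidableEq κ] {e : κ → ι}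
    (he : Function.Injective e) (θ : ι → ℝ) (q : κ) (s : ℝ) :
    (fun p => Function.update θ (e q) s (e p)) = Function.update (fun p => θ (e p)) q s := by
  funext p
  by_cases h : p = q
  · subst h; simp
  · rw [Function.update_of_ne h, Function.update_of_ne (fun h' => h (he h'))]

theorem update_comp_ne {ι κ : Type} [DecidableEq ι] {e : κ → ι}
    (θ : ι → ℝ) (q : ι) (h : ∀ p, e p ≠ q) (s : ℝ) :
    (fun p => Function.update θ q s (e p)) = (fun p => θ (e p)) := by
  funext p
  rw [Function.update_of_ne (h p)]

theorem eRoot_inj (l r : BTree) (F : ℕ) : Function.Injective (eRoot l r (F := F)) :=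
  fun a b h => Sum.inl_injective (@eAll_inj l r F (.inl a) (.inl b) h)
theorem eL_inj (l r : BTree) (F : ℕ) : Function.Injective (eL l r (F := F)) :=
  fun a b h => Sum.inl_injective (Sum.inr_injective (@eAll_inj l r F (.inr (.inl a)) (.inr (.inl b)) h))
theorem eR_inj (l r : BTree) (F : ℕ) : Function.Injective (eR l r (F := F)) :=
  fun a b h => Sum.inr_injective (Sum.inr_injective (@eAll_inj l r F (.inr (.inr a)) (.inr (.inr b)) h))
theorem eRoot_ne_eL (l r : BTree) {F : ℕ} (k : Fin F) (p : TParam l F) :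
    eRoot l r k ≠ eL l r p := by
  intro h; simpa using @eAll_inj l r F (.inl k) (.inr (.inl p)) h
theorem eRoot_ne_eR (l r : BTree) {F : ℕ} (k : Fin F) (p : TParam r F) :
    eRoot l r k ≠ eR l r p := by
  intro h; simpa using @eAll_inj l r F (.inl k) (.inr (.inr p)) h
theorem eL_ne_eR (l r : BTree) {F : ℕ} (q : TParam l F) (p : TParam r F) :
    eL l r q ≠ eR l r p := by
  intro h; simpa using @eAll_inj l r F (.inr (.inl q)) (.inr (.inr p)) h

theorem dot_update {F : ℕ} (w x : Fin F → ℝ) (k : Fin F) (s : ℝ) :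
    dot (Function.update w k s) x = dot w x + (s - w k) * x k := by
  have : ∀ i, Function.update w k s i * x i = w i * x i + (if i = k then (s - w k) * x k else 0) := by
    intro i
    by_cases h : i = k
    · subst h; simp; ring
    · simp [h]
  simp only [dot, this, Finset.sum_add_distrib]
  simp

theorem pderiv_root {F : ℕ} {σ : ℝ → ℝ} (hσ : Differentiable ℝ σ) (l r : BTree)
    (θ : TParam (.node l r) F → ℝ) (x : Fin F → ℝ) (k : Fin F) :
    pderiv (fun θ' => treeF σ (.node l r) θ' x) θ (eRoot l r k) =
      x k * (deriv σ (dot (fun k => θ (eRoot l r k)) x) *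
        (treeF σ l (fun p => θ (eL l r p)) x - treeF σ r (fun p => θ (eR l r p)) x)) := by
  simp only [pderiv, treeF_node]
  simp only [update_comp_inj (eRoot_inj l r F),
    update_comp_ne θ (eRoot l r k) (fun p => (eRoot_ne_eL l r k p).symm),
    update_comp_ne θ (eRoot l r k) (fun p => (eRoot_ne_eR l r k p).symm), dot_update]
  set w := fun k => θ (eRoot l r k)
  have h1 : HasDerivAt (fun s : ℝ => dot w x + (s - w k) * x k) (x k) (θ (eRoot l r k)) := by
    simpa using ((((hasDerivAt_id (θ (eRoot l r k))).sub_const (w k)).mul_const (x k)).const_add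
      (dot w x))
  have h0 : dot w x + (θ (eRoot l r k) - w k) * x k = dot w x := by simp [w]
  have h2 : HasDerivAt (fun s : ℝ => σ (dot w x + (s - w k) * x k)) (deriv σ (dot w x) * x k)
      (θ (eRoot l r k)) := by
    have h4 : HasDerivAt σ (deriv σ (dot w x)) (dot w x + (θ (eRoot l r k) - w k) * x k) := by
      rw [h0]; exact (hσ _).hasDerivAt
    exact HasDerivAt.comp (θ (eRoot l r k)) h4 h1
  have h3 := (h2.mul_const (treeF σ l (fun p => θ (eL l r p)) x)).add
    ((h2.const_sub 1).mul_const (treeF σ r (fun p => θ (eR l r p)) x))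
  refine h3.deriv.trans ?_
  ring

theorem pderiv_left {F : ℕ} {σ : ℝ → ℝ} (l r : BTree)
    (θ : TParam (.node l r) F → ℝ) (x : Fin F → ℝ) (q : TParam l F) :
    pderiv (fun θ' => treeF σ (.node l r) θ' x) θ (eL l r q) =
      σ (dot (fun k => θ (eRoot l r k)) x) *
        pderiv (fun θ' => treeF σ l θ' x) (fun p => θ (eL l r p)) q := by
  simp only [pderiv, treeF_node]
  simp only [update_comp_inj (eL_inj l r F),
    update_comp_ne θ (eL l r q) (fun p => (eRoot_ne_eL l r p q)),
    update_comp_ne θ (eL l r q) (fun p => (eL_ne_eR l r q p).symm)]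
  rw [deriv_add_const, deriv_const_mul_field]

theorem pderiv_right {F : ℕ} {σ : ℝ → ℝ} (l r : BTree)
    (θ : TParam (.node l r) F → ℝ) (x : Fin F → ℝ) (q : TParam r F) :
    pderiv (fun θ' => treeF σ (.node l r) θ' x) θ (eR l r q) =
      (1 - σ (dot (fun k => θ (eRoot l r k)) x)) *
        pderiv (fun θ' => treeF σ r θ' x) (fun p => θ (eR l r p)) q := by
  simp only [pderiv, treeF_node]
  simp only [update_comp_inj (eR_inj l r F),
    update_comp_ne θ (eR l r q) (fun p => (eRoot_ne_eR l r p q)),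
    update_comp_ne θ (eR l r q) (fun p => (eL_ne_eR l r p q))]
  rw [deriv_const_add, deriv_const_mul_field]

theorem K_node {F : ℕ} {σ : ℝ → ℝ} (hσ : Differentiable ℝ σ) (l r : BTree)
    (xi xj : Fin F → ℝ) (θ : TParam (.node l r) F → ℝ) :
    K σ (.node l r) xi xj θ =
      dot xi xj * ((deriv σ (dot (fun k => θ (eRoot l r k)) xi) *
        (treeF σ l (fun p => θ (eL l r p)) xi - treeF σ r (fun p => θ (eR l r p)) xi)) *
       (deriv σ (dot (fun k => θ (eRoot l r k)) xj) *
        (treeF σ l (fun p => θ (eL l r p)) xj - treeF σ r (fun p => θ (eR l r p)) xj)))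
      + (σ (dot (fun k => θ (eRoot l r k)) xi) * σ (dot (fun k => θ (eRoot l r k)) xj) *
          K σ l xi xj (fun p => θ (eL l r p))
      + (1 - σ (dot (fun k => θ (eRoot l r k)) xi)) * (1 - σ (dot (fun k => θ (eRoot l r k)) xj)) *
          K σ r xi xj (fun p => θ (eR l r p))) := by
  unfold K empNTK
  rw [← (eEquiv l r F).sum_comp, Fintype.sum_sum_type, Fintype.sum_sum_type]
  have e1 : ∀ k, eEquiv l r F (.inl k) = eRoot l r k := fun _ => rfl
  have e2 : ∀ k, eEquiv l r F (.inr (.inl k)) = eL l r k := fun _ => rfl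
  have e3 : ∀ k, eEquiv l r F (.inr (.inr k)) = eR l r k := fun _ => rfl
  simp only [e1, e2, e3, pderiv_root hσ, pderiv_left, pderiv_right]
  congr 1
  · rw [show dot xi xj = ∑ k, xi k * xj k from rfl, Finset.sum_mul]
    exact Finset.sum_congr rfl fun k _ => by ring
  · congr 1
    · rw [Finset.mul_sum]
      exact Finset.sum_congr rfl fun k _ => by ring
    · rw [Finset.mul_sum]
      exact Finset.sum_congr rfl fun k _ => by ring

theorem pderiv_ensemble {F : ℕ} (σ : ℝ → ℝ) (t : BTree) (M : ℕ) (θ : Fin M × TParam t F → ℝ)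
    (x : Fin F → ℝ) (m : Fin M) (p : TParam t F) :
    pderiv (fun θ' => ensembleF σ t M θ' x) θ (m, p) =
      (1 / Real.sqrt M) * pderiv (fun θ' => treeF σ t θ' x) (fun q => θ (m, q)) p := by
  simp only [pderiv, ensembleF]
  rw [deriv_const_mul_field]
  congr 1
  have : ∀ s, ∑ m' : Fin M, treeF σ t (fun q => Function.update θ (m, p) s (m', q)) x =
      treeF σ t (Function.update (fun q => θ (m, q)) p s) x +
        ∑ m' ∈ Finset.univ.erase m, treeF σ t (fun q => θ (m', q)) x := by
    intro s
    rw [← Finset.add_sum_erase _ _ (Finset.mem_univ m)]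
    congr 1
    · rw [update_comp_inj (e := fun q : TParam t F => (m, q)) (Prod.mk_right_injective m)]
    · refine Finset.sum_congr rfl fun m' hm' => ?_
      rw [update_comp_ne (e := fun q : TParam t F => (m', q))]
      intro q h
      exact (Finset.ne_of_mem_erase hm') (congrArg Prod.fst h)
  simp only [this]
  rw [deriv_add_const]

theorem empNTK_ensemble {F : ℕ} (σ : ℝ → ℝ) (t : BTree) (M : ℕ) (θ : Fin M × TParam t F → ℝ)
    (xi xj : Fin F → ℝ) :
    empNTK (ensembleF σ t M) θ xi xj = (1 / (M:ℝ)) * ∑ m, K σ t xi xj (fun q => θ (m, q)) := by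
  unfold K empNTK
  rw [Fintype.sum_prod_type, Finset.mul_sum]
  refine Finset.sum_congr rfl fun m _ => ?_
  rw [Finset.mul_sum]
  refine Finset.sum_congr rfl fun p _ => ?_
  rw [pderiv_ensemble, pderiv_ensemble]
  have : (1 / (M:ℝ)) = (1 / Real.sqrt M) * (1 / Real.sqrt M) := by
    rw [div_mul_div_comm, Real.mul_self_sqrt (Nat.cast_nonneg M), one_mul]
  rw [this]; ring

theorem treeF_leaf {F : ℕ} (σ : ℝ → ℝ) (θ : TParam .leaf F → ℝ) (x : Fin F → ℝ) :
    treeF σ .leaf θ x = θ (Sum.inr ⟨[], by simp [BTree.leafFinset, BTree.leafPaths]⟩) := by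
  simp [treeF, BTree.leafPaths, piOf, pathProd, BTree.leafFinset]

theorem K_leaf {F : ℕ} (σ : ℝ → ℝ) (xi xj : Fin F → ℝ) (θ : TParam .leaf F → ℝ) :
    K σ .leaf xi xj θ = 1 := by
  unfold K empNTK
  rw [Fintype.sum_eq_single (Sum.inr ⟨[], by simp [BTree.leafFinset, BTree.leafPaths]⟩)]
  · simp [pderiv, treeF_leaf]
  · rintro (⟨⟨a, ha⟩, k⟩ | ⟨a, ha⟩) h
    · simp [BTree.nodeFinset, BTree.nodePaths] at ha
    · simp [BTree.leafFinset, BTree.leafPaths] at ha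
      subst ha
      exact absurd rfl h

/-- the two tree functionals -/
def S (T : ℝ) (t : BTree) : ℝ := (t.leafPaths.map fun p => T ^ p.length).sum
def N (c T : ℝ) (t : BTree) : ℝ :=
  (t.leafPaths.map fun p => T ^ p.length + c * p.length * T ^ (p.length - 1)).sum

theorem S_node (T : ℝ) (l r : BTree) : S T (.node l r) = T * S T l + T * S T r := by
  simp only [S, BTree.leafPaths, List.map_append, List.sum_append, List.map_map]
  rw [← List.sum_map_mul_left, ← List.sum_map_mul_left]
  congr 2 <;>
  · apply List.map_congr_left
    intro a _
    simp [pow_succ']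

theorem N_node (c T : ℝ) (l r : BTree) :
    N c T (.node l r) = c * (S T l + S T r) + (T * N c T l + T * N c T r) := by
  have key : ∀ d : ℕ, T ^ (d + 1) + c * ((d + 1 : ℕ) : ℝ) * T ^ (d + 1 - 1) =
      c * T ^ d + T * (T ^ d + c * d * T ^ (d - 1)) := by
    intro d
    cases d with
    | zero => simp; ring
    | succ d => simp; ring
  have h : ∀ t : BTree, (t.leafPaths.map fun p => T ^ (p.length + 1) +
      c * ((p.length + 1 : ℕ) : ℝ) * T ^ (p.length + 1 - 1)).sum = c * S T t + T * N c T t := by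
    intro t
    simp only [key, List.sum_map_add, List.sum_map_mul_left, S, N]
  have : N c T (.node l r) = (c * S T l + T * N c T l) + (c * S T r + T * N c T r) := by
    rw [← h, ← h]
    simp only [N, BTree.leafPaths, List.map_append, List.sum_append, List.map_map]
    rfl
  rw [this]; ring

theorem N_congr (c T : ℝ) (A B : BTree) (hQ : ∀ d : ℕ, A.Q d = B.Q d) : N c T A = N c T B := by
  have hN : ∀ t : BTree, N c T t = ((t.leafPaths.map List.length).map
      fun d : ℕ => T ^ d + c * d * T ^ (d - 1)).sum := by
    intro t; rw [List.map_map]; rfl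
  have hp : (A.leafPaths.map List.length).Perm (B.leafPaths.map List.length) := by
    rw [List.perm_iff_count]
    intro d
    have hc : ∀ t : BTree, (t.leafPaths.map List.length).count d = t.Q d := by
      intro t
      rw [BTree.Q, List.count, List.countP_map, List.countP_eq_length_filter]
      rfl
    rw [hc, hc, hQ]
  rw [hN, hN]
  exact (hp.map _).sum_eq

instance instInit (ι : Type) [Fintype ι] : IsProbabilityMeasure (initMeasure ι) := by
  unfold initMeasure; infer_instance

instance instStd (F : ℕ) : IsProbabilityMeasure (stdGauss F) := by
  unfold stdGauss; infer_instance

def split (l r : BTree) (F : ℕ) (θ : TParam (.node l r) F → ℝ) :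
    (Fin F → ℝ) × ((TParam l F → ℝ) × (TParam r F → ℝ)) :=
  (fun k => θ (eRoot l r k), fun p => θ (eL l r p), fun p => θ (eR l r p))

theorem mp_split (l r : BTree) (F : ℕ) :
    MeasurePreserving (split l r F) (initMeasure (TParam (.node l r) F))
      ((stdGauss F).prod ((initMeasure (TParam l F)).prod (initMeasure (TParam r F)))) := by
  have h1 := MeasurePreserving.symm _ (measurePreserving_piCongrLeft
    (fun _ : TParam (.node l r) F => gaussianReal 0 1) (eEquiv l r F))
  have h2 := measurePreserving_sumPiEquivProdPi
    (fun _ : Fin F ⊕ (TParam l F ⊕ TParam r F) => gaussianReal 0 1)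
  have h3 := measurePreserving_sumPiEquivProdPi
    (fun _ : (TParam l F ⊕ TParam r F) => gaussianReal 0 1)
  have h4 := (((MeasurePreserving.id (stdGauss F)).prod h3).comp h2).comp h1
  exact h4

/-- integrable with a given expectation -/
def HasE {Ω : Type} [MeasurableSpace Ω] (μ : Measure Ω) (X : Ω → ℝ) (v : ℝ) : Prop :=
  Integrable X μ ∧ ∫ z, X z ∂μ = v

theorem HasE.add {Ω : Type} [MeasurableSpace Ω] {μ : Measure Ω} {X Y : Ω → ℝ} {v w : ℝ}
    (hX : HasE μ X v) (hY : HasE μ Y w) : HasE μ (fun z => X z + Y z) (v + w) :=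
  ⟨hX.1.add hY.1, by rw [integral_add hX.1 hY.1, hX.2, hY.2]⟩

theorem HasE.cmul {Ω : Type} [MeasurableSpace Ω] {μ : Measure Ω} {X : Ω → ℝ} {v : ℝ} (c : ℝ)
    (hX : HasE μ X v) : HasE μ (fun z => c * X z) (c * v) :=
  ⟨hX.1.const_mul c, by rw [integral_const_mul, hX.2]⟩

theorem HasE.congr {Ω : Type} [MeasurableSpace Ω] {μ : Measure Ω} {X Y : Ω → ℝ} {v w : ℝ}
    (hX : HasE μ X v) (h : ∀ z, Y z = X z) (hv : w = v) : HasE μ Y w := by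
  obtain rfl : Y = X := funext h
  rw [hv]; exact hX

theorem HasE.of_int {Ω : Type} [MeasurableSpace Ω] {μ : Measure Ω} {X : Ω → ℝ}
    (hX : Integrable X μ) : HasE μ X (∫ z, X z ∂μ) := ⟨hX, rfl⟩

theorem HasE.one {Ω : Type} [MeasurableSpace Ω] {μ : Measure Ω} [IsProbabilityMeasure μ] :
    HasE μ (fun _ => (1:ℝ)) 1 := ⟨integrable_const _, by simp⟩

theorem HasE.mul3 {W L R : Type} [MeasurableSpace W] [MeasurableSpace L] [MeasurableSpace R]
    {μ : Measure W} {ν : Measure L} {ρ : Measure R} [SFinite μ] [SFinite ν] [SFinite ρ]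
    {a : W → ℝ} {b : L → ℝ} {c : R → ℝ} {u v w : ℝ}
    (ha : HasE μ a u) (hb : HasE ν b v) (hc : HasE ρ c w) :
    HasE (μ.prod (ν.prod ρ)) (fun z => a z.1 * (b z.2.1 * c z.2.2)) (u * (v * w)) := by
  refine ⟨ha.1.mul_prod (hb.1.mul_prod hc.1), ?_⟩
  rw [integral_prod_mul (μ := μ) (ν := ν.prod ρ) a (fun y => b y.1 * c y.2), integral_prod_mul,
    ha.2, hb.2, hc.2]

theorem HasE.comp_mp {Ω Ω' : Type} [MeasurableSpace Ω] [MeasurableSpace Ω'] {μ : Measure Ω}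
    {μ' : Measure Ω'} {φ : Ω → Ω'} (hφ : MeasurePreserving φ μ μ') {X : Ω' → ℝ} {v : ℝ}
    (hX : HasE μ' X v) : HasE μ (fun z => X (φ z)) v := by
  refine ⟨hφ.integrable_comp_of_integrable hX.1, ?_⟩
  rw [← hX.2, ← hφ.map_eq, integral_map hφ.measurable.aemeasurable]
  rw [hφ.map_eq]; exact hX.1.1

instance holder442 : ENNReal.HolderTriple 4 4 2 := ⟨by
  rw [← two_mul, show (4:ENNReal) = 2 * 2 by norm_num, ENNReal.mul_inv (by simp) (by simp),
    ← mul_assoc, ENNReal.mul_inv_cancel (by simp) (by simp), one_mul]⟩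

section step

variable {W L R : Type} [MeasurableSpace W] [MeasurableSpace L] [MeasurableSpace R]
    {μ : Measure W} {ν : Measure L} {ρ : Measure R} [IsProbabilityMeasure μ]
    [IsProbabilityMeasure ν] [IsProbabilityMeasure ρ]

theorem memLp_prod_fst {p : ENNReal} {a : W → ℝ} (ha : MemLp a p μ) :
    MemLp (fun z : W × (L × R) => a z.1) p (μ.prod (ν.prod ρ)) :=
  ha.comp_measurePreserving measurePreserving_fst

theorem memLp_prod_snd {p : ENNReal} {b : L → ℝ} (hb : MemLp b p ν) :
    MemLp (fun z : W × (L × R) => b z.2.1) p (μ.prod (ν.prod ρ)) :=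
  hb.comp_measurePreserving (measurePreserving_fst.comp measurePreserving_snd)

theorem memLp_prod_thd {p : ENNReal} {c : R → ℝ} (hc : MemLp c p ρ) :
    MemLp (fun z : W × (L × R) => c z.2.2) p (μ.prod (ν.prod ρ)) :=
  hc.comp_measurePreserving (measurePreserving_snd.comp measurePreserving_snd)

theorem memLp_bdd_mul {Ω : Type} [MeasurableSpace Ω] {κ : Measure Ω} {p : ENNReal} {a b : Ω → ℝ}
    (ha : MemLp a ⊤ κ) (hb : MemLp b p κ) : MemLp (fun z => a z * b z) p κ :=
  MemLp.mul (p := ⊤) (q := p) (r := p) hb ha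

theorem int_mul {Ω : Type} [MeasurableSpace Ω] {κ : Measure Ω} [IsProbabilityMeasure κ]
    {a b : Ω → ℝ} (ha : MemLp a 4 κ) (hb : MemLp b 4 κ) : Integrable (fun z => a z * b z) κ :=
  (MemLp.mul (p := 4) (q := 4) (r := 2) hb ha).integrable (by norm_num)

theorem int_of {Ω : Type} [MeasurableSpace Ω] {κ : Measure Ω} [IsProbabilityMeasure κ]
    {a : Ω → ℝ} (ha : MemLp a ⊤ κ) : Integrable a κ :=
  ha.integrable le_top

theorem one_sub_top {Ω : Type} [MeasurableSpace Ω] {κ : Measure Ω} [IsProbabilityMeasure κ]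
    {a : Ω → ℝ} (ha : MemLp a ⊤ κ) : MemLp (fun z => 1 - a z) ⊤ κ :=
  (memLp_const (1:ℝ)).sub ha

theorem step_mem {p : ENNReal} {a a' : W → ℝ} {f : L → ℝ} {g : R → ℝ}
    (ha : MemLp a ⊤ μ) (ha' : MemLp a' ⊤ μ) (hf : MemLp f p ν) (hg : MemLp g p ρ) :
    MemLp (fun z : W × (L × R) => a z.1 * f z.2.1 + a' z.1 * g z.2.2) p
      (μ.prod (ν.prod ρ)) :=
  (memLp_bdd_mul (memLp_prod_fst ha) (memLp_prod_snd hf)).add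
    (memLp_bdd_mul (memLp_prod_fst ha') (memLp_prod_thd hg))

theorem step_mean {a a' : W → ℝ} {f : L → ℝ} {g : R → ℝ}
    (ha : MemLp a ⊤ μ) (ha' : MemLp a' ⊤ μ) (hf : HasE ν f 0) (hg : HasE ρ g 0) :
    HasE (μ.prod (ν.prod ρ)) (fun z : W × (L × R) => a z.1 * f z.2.1 + a' z.1 * g z.2.2) 0 := by
  refine HasE.congr (((HasE.of_int (int_of ha)).mul3 hf HasE.one).add
    ((HasE.of_int (int_of ha')).mul3 HasE.one hg)) (fun z => by ring) (by ring)

/-- second moments of `a f + b g` -/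
theorem step_sec {a b a' b' : W → ℝ} {f f' : L → ℝ} {g g' : R → ℝ} {u v s t : ℝ}
    (ha : MemLp a ⊤ μ) (ha' : MemLp a' ⊤ μ) (hb : MemLp b ⊤ μ) (hb' : MemLp b' ⊤ μ)
    (hu : ∫ w, a w * a' w ∂μ = u) (hv : ∫ w, b w * b' w ∂μ = v)
    (hf : HasE ν f 0) (hf' : HasE ν f' 0) (hg : HasE ρ g 0) (hg' : HasE ρ g' 0)
    (hff : HasE ν (fun z => f z * f' z) s) (hgg : HasE ρ (fun z => g z * g' z) t) :
    HasE (μ.prod (ν.prod ρ)) (fun z : W × (L × R) =>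
      (a z.1 * f z.2.1 + b z.1 * g z.2.2) * (a' z.1 * f' z.2.1 + b' z.1 * g' z.2.2))
      (u * s + v * t) := by
  have h1 := (HasE.of_int (int_of (memLp_bdd_mul ha ha'))).mul3 hff (HasE.one (μ := ρ))
  have h2 := (HasE.of_int (int_of (memLp_bdd_mul hb hb'))).mul3 (HasE.one (μ := ν)) hgg
  have h3 := (HasE.of_int (int_of (memLp_bdd_mul ha hb'))).mul3 hf hg'
  have h4 := (HasE.of_int (int_of (memLp_bdd_mul hb ha'))).mul3 hf' hg
  refine ((h1.add h2).add (h3.add h4)).congr (fun z => by ring) ?_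
  rw [hu, hv]; ring

theorem step_lin {a b : W → ℝ} {f : L → ℝ} {g : R → ℝ} {u v s t : ℝ}
    (ha : MemLp a ⊤ μ) (hb : MemLp b ⊤ μ) (hu : ∫ w, a w ∂μ = u) (hv : ∫ w, b w ∂μ = v)
    (hf : HasE ν f s) (hg : HasE ρ g t) :
    HasE (μ.prod (ν.prod ρ)) (fun z : W × (L × R) => a z.1 * f z.2.1 + b z.1 * g z.2.2)
      (u * s + v * t) := by
  refine HasE.congr (((HasE.of_int (int_of ha)).mul3 hf HasE.one).add
    ((HasE.of_int (int_of hb)).mul3 HasE.one hg)) (fun z => by ring) ?_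
  rw [hu, hv]; ring

end step

section main

variable {F : ℕ} {σ : ℝ → ℝ}

theorem measurable_dot (x : Fin F → ℝ) : Measurable (fun u : Fin F → ℝ => dot u x) := by
  unfold dot; fun_prop

theorem sig_top (hσ : IsDecisionFunc σ) (x : Fin F → ℝ) :
    MemLp (fun u => σ (dot u x)) ⊤ (stdGauss F) := by
  refine MemLp.of_bound ?_ 1 (Eventually.of_forall fun u => ?_)
  · exact (hσ.differentiable.continuous.measurable.comp (measurable_dot x)).aestronglyMeasurable
  · have := hσ.mem_Icc (dot u x)
    rw [Real.norm_eq_abs, abs_le]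
    constructor <;> linarith [this.1, this.2]

theorem dsig_top (hσ : IsDecisionFunc σ) (x : Fin F → ℝ) :
    MemLp (fun u => deriv σ (dot u x)) ⊤ (stdGauss F) := by
  obtain ⟨C, hC⟩ := hσ.deriv_bounded
  refine MemLp.of_bound ?_ C (Eventually.of_forall fun u => hC _)
  exact ((measurable_deriv σ).comp (measurable_dot x)).aestronglyMeasurable

theorem mp_neg : MeasurePreserving (fun (u : Fin F → ℝ) k => -u k) (stdGauss F) (stdGauss F) := by
  have : MeasurePreserving (fun x : ℝ => -x) (gaussianReal 0 1) (gaussianReal 0 1) :=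
    ⟨measurable_neg, by rw [gaussianReal_map_neg, neg_zero]⟩
  exact measurePreserving_pi _ _ (fun _ => this)

theorem int_symm (hσ : IsDecisionFunc σ) (xi xj : Fin F → ℝ) :
    ∫ u, (1 - σ (dot u xi)) * (1 - σ (dot u xj)) ∂ stdGauss F = Tker σ xi xj := by
  have h := HasE.comp_mp mp_neg (HasE.of_int (int_of
    (memLp_bdd_mul (sig_top hσ xi) (sig_top hσ xj))))
  refine Eq.trans ?_ h.2
  refine integral_congr_ae (Eventually.of_forall fun u => ?_)
  have hd : ∀ x : Fin F → ℝ, dot (fun k => -u k) x = - dot u x := by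
    intro x; simp [dot]
  simp only [hd]
  rw [show 1 - σ (dot u xi) = σ (-dot u xi) by linarith [hσ.symm (dot u xi)],
    show 1 - σ (dot u xj) = σ (-dot u xj) by linarith [hσ.symm (dot u xj)]]

theorem tree_mem (hσ : IsDecisionFunc σ) (t : BTree) (x : Fin F → ℝ) :
    MemLp (fun θ => treeF σ t θ x) 4 (initMeasure (TParam t F)) := by
  induction t with
  | leaf =>
    simp only [treeF_leaf]
    exact (memLp_id_gaussianReal' 4 (by norm_num)).comp_measurePreserving
      (measurePreserving_eval (fun _ : TParam .leaf F => gaussianReal 0 1) _)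
  | node l r hl hr =>
    simp only [treeF_node]
    exact (step_mem (sig_top hσ x) (one_sub_top (sig_top hσ x)) hl hr).comp_measurePreserving
      (mp_split l r F)

theorem tree_mean (hσ : IsDecisionFunc σ) (t : BTree) (x : Fin F → ℝ) :
    HasE (initMeasure (TParam t F)) (fun θ => treeF σ t θ x) 0 := by
  induction t with
  | leaf =>
    simp only [treeF_leaf]
    refine HasE.comp_mp (X := id)
      (measurePreserving_eval (fun _ : TParam .leaf F => gaussianReal 0 1) _) ⟨?_, ?_⟩
    · exact (memLp_id_gaussianReal' 1 (by norm_num)).integrable le_rfl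
    · simp [integral_id_gaussianReal]
  | node l r hl hr =>
    simp only [treeF_node]
    exact (step_mean (sig_top hσ x) (one_sub_top (sig_top hσ x)) hl hr).comp_mp (mp_split l r F)

theorem tree_sec (hσ : IsDecisionFunc σ) (t : BTree) (xi xj : Fin F → ℝ) :
    HasE (initMeasure (TParam t F)) (fun θ => treeF σ t θ xi * treeF σ t θ xj)
      (S (Tker σ xi xj) t) := by
  induction t with
  | leaf =>
    simp only [treeF_leaf]
    have hm := memLp_id_gaussianReal' (μ := 0) (v := 1) 4 (by norm_num)
    refine HasE.comp_mp (X := fun z => z * z)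
      (measurePreserving_eval (fun _ : TParam .leaf F => gaussianReal 0 1) _) ⟨int_mul hm hm, ?_⟩
    have h := variance_id_gaussianReal (μ := 0) (v := 1)
    rw [variance_of_integral_eq_zero aemeasurable_id (by simp [integral_id_gaussianReal])] at h
    simp only [id, NNReal.coe_one] at h
    simp only [S, BTree.leafPaths, ← pow_two]
    simpa using h
  | node l r hl hr =>
    simp only [treeF_node]
    rw [S_node]
    exact (step_sec (sig_top hσ xi) (sig_top hσ xj) (one_sub_top (sig_top hσ xi))
      (one_sub_top (sig_top hσ xj)) rfl (int_symm hσ xi xj) (tree_mean hσ l xi) (tree_mean hσ l xj)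
      (tree_mean hσ r xi) (tree_mean hσ r xj) hl hr).comp_mp (mp_split l r F)

theorem K_mem (hσ : IsDecisionFunc σ) (t : BTree) (xi xj : Fin F → ℝ) :
    MemLp (K σ t xi xj) 2 (initMeasure (TParam t F)) := by
  induction t with
  | leaf =>
    rw [show K σ .leaf xi xj = fun _ => 1 from funext (K_leaf σ xi xj)]
    exact memLp_const 1
  | node l r hl hr =>
    have hd : ∀ x, MemLp (fun z : (Fin F → ℝ) × ((TParam l F → ℝ) × (TParam r F → ℝ)) =>
        deriv σ (dot z.1 x) * (treeF σ l z.2.1 x - treeF σ r z.2.2 x)) 4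
        ((stdGauss F).prod ((initMeasure (TParam l F)).prod (initMeasure (TParam r F)))) :=
      fun x => memLp_bdd_mul (memLp_prod_fst (dsig_top hσ x))
        ((memLp_prod_snd (tree_mem hσ l x)).sub (memLp_prod_thd (tree_mem hσ r x)))
    have h0 := MemLp.mul (p := 4) (q := 4) (r := 2) (hd xj) (hd xi)
    have h1 := h0.const_mul (dot xi xj)
    have h2 := step_mem (memLp_bdd_mul (sig_top hσ xi) (sig_top hσ xj))
      (memLp_bdd_mul (one_sub_top (sig_top hσ xi)) (one_sub_top (sig_top hσ xj))) hl hr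
    have h3 := (h1.add h2).comp_measurePreserving (mp_split l r F)
    refine h3.ae_eq (Eventually.of_forall fun θ => ?_)
    rw [K_node hσ.differentiable]
    simp only [split, Function.comp, Pi.add_apply, Pi.mul_apply]

theorem K_mean (hσ : IsDecisionFunc σ) (t : BTree) (xi xj : Fin F → ℝ) :
    HasE (initMeasure (TParam t F)) (K σ t xi xj)
      (N (dot xi xj * Tdot σ xi xj) (Tker σ xi xj) t) := by
  induction t with
  | leaf =>
    rw [show K σ .leaf xi xj = fun _ => 1 from funext (K_leaf σ xi xj)]
    refine HasE.one.congr (fun _ => rfl) ?_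
    simp [N, BTree.leafPaths]
  | node l r hl hr =>
    have hneg : ∀ x, MemLp (fun u => -deriv σ (dot u x)) ⊤ (stdGauss F) :=
      fun x => (dsig_top hσ x).neg
    have h1 := (step_sec (v := Tdot σ xi xj) (dsig_top hσ xi) (dsig_top hσ xj) (hneg xi) (hneg xj)
      rfl (by simp only [neg_mul_neg]; rfl) (tree_mean hσ l xi) (tree_mean hσ l xj)
      (tree_mean hσ r xi) (tree_mean hσ r xj) (tree_sec hσ l xi xj) (tree_sec hσ r xi xj)).cmul
      (dot xi xj)
    have h2 := step_lin (memLp_bdd_mul (sig_top hσ xi) (sig_top hσ xj))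
      (memLp_bdd_mul (one_sub_top (sig_top hσ xi)) (one_sub_top (sig_top hσ xj))) rfl
      (int_symm hσ xi xj) hl hr
    refine ((h1.add h2).comp_mp (mp_split l r F)).congr (fun θ => ?_) ?_
    · rw [K_node hσ.differentiable]
      simp only [split]
      ring
    · rw [N_node]
      simp only [Tker, Tdot]
      ring

theorem mp_curry (M : ℕ) (P : Type) [Fintype P] :
    MeasurePreserving (fun (θ : Fin M × P → ℝ) m p => θ (m, p)) (initMeasure (Fin M × P))
      (Measure.pi fun _ : Fin M => initMeasure P) := by
  refine ⟨by fun_prop, ?_⟩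
  have h := Measure.infinitePi_map_curry (fun (_ : Fin M) (_ : P) => gaussianReal 0 1)
  simp only [Measure.infinitePi_eq_pi] at h
  exact h

theorem wlln {P : Type} [Fintype P] {X : (P → ℝ) → ℝ} {v : ℝ}
    (hX : MemLp X 2 (initMeasure P)) (hv : ∫ z, X z ∂initMeasure P = v) (ε : ℝ) (hε : 0 < ε) :
    Tendsto (fun M : ℕ => initMeasure (Fin M × P)
      {θ | ε ≤ |(1 / (M:ℝ)) * ∑ m, X (fun q => θ (m, q)) - v|}) atTop (nhds 0) := by
  have hb : ∀ M : ℕ, 0 < M → initMeasure (Fin M × P)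
      {θ | ε ≤ |(1 / (M:ℝ)) * ∑ m, X (fun q => θ (m, q)) - v|} ≤
      ENNReal.ofReal ((1 / (M:ℝ)) * (variance X (initMeasure P) / ε ^ 2)) := by
    intro M hM
    have hM' : (M:ℝ) ≠ 0 := by positivity
    set μ := Measure.pi fun _ : Fin M => initMeasure P
    have hm : ∀ m, MemLp (fun ω : Fin M → P → ℝ => X (ω m)) 2 μ := fun m =>
      hX.comp_measurePreserving (measurePreserving_eval (fun _ : Fin M => initMeasure P) m)
    have hE : ∀ m, HasE μ (fun ω : Fin M → P → ℝ => X (ω m)) v := fun m =>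
      HasE.comp_mp (measurePreserving_eval (fun _ : Fin M => initMeasure P) m)
        ⟨hX.integrable (by norm_num), hv⟩
    have hvar := variance_sum_pi (μ := fun _ : Fin M => initMeasure P) (X := fun _ => X)
      (fun _ => hX)
    have hmem : MemLp (∑ m, fun ω : Fin M → P → ℝ => X (ω m)) 2 μ :=
      memLp_finsetSum' _ fun m _ => hm m
    set Y : (Fin M → P → ℝ) → ℝ := fun ω => (1 / (M:ℝ)) *
      (∑ m, fun ω : Fin M → P → ℝ => X (ω m)) ω with hY
    have hYm : MemLp Y 2 μ := hmem.const_mul _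
    have hYE : ∫ ω, Y ω ∂μ = v := by
      simp only [hY, Finset.sum_apply]
      rw [integral_const_mul, integral_finsetSum _ fun m _ => (hE m).1]
      simp only [(hE _).2]
      simp
      field_simp
    have hYv : variance Y μ = (1 / (M:ℝ)) * variance X (initMeasure P) := by
      rw [hY, variance_const_mul, hvar]
      simp
      field_simp
    have hc := meas_ge_le_variance_div_sq hYm hε
    rw [hYE, hYv] at hc
    refine le_trans ?_ (hc.trans (le_of_eq (by rw [mul_div_assoc])))
    refine le_trans (le_of_eq ?_) ((mp_curry M P).measure_preimage_le _)
    congr 1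
    ext θ
    simp [hY]
  refine tendsto_of_tendsto_of_tendsto_of_le_of_le' tendsto_const_nhds
    (h := fun M : ℕ => ENNReal.ofReal ((1 / (M:ℝ)) * (variance X (initMeasure P) / ε ^ 2)))
    ?_ (Eventually.of_forall fun _ => zero_le) ((eventually_gt_atTop 0).mono hb)
  have h := ENNReal.tendsto_ofReal
    ((tendsto_one_div_atTop_nhds_zero_nat (𝕜 := ℝ)).mul_const (variance X (initMeasure P) / ε ^ 2))
  simpa using h

end main

end SoftTree

/-- If two tree architectures `A` and `B` (possibly non-isomorphic) have the same
leaf-count function, i.e. the same number of leaves at every depth, then the empirical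
NTKs at the NTK initialization of ensembles of `M` soft trees of architecture `A` and of
architecture `B` converge in probability, as `M → ∞`, to the same deterministic limit. -/
theorem stmt7 (F : ℕ) (hF : 1 ≤ F) (σ : ℝ → ℝ) (hσ : IsDecisionFunc σ)
    (A B : BTree) (hQ : ∀ d : ℕ, A.Q d = B.Q d) (xi xj : Fin F → ℝ) :
    ∃ L : ℝ,
      (∀ ε > (0:ℝ), Tendsto
        (fun M : ℕ => initMeasure (Fin M × TParam A F)
          {θ | ε ≤ |empNTK (ensembleF σ A M) θ xi xj - L|})
        atTop (nhds 0)) ∧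
      (∀ ε > (0:ℝ), Tendsto
        (fun M : ℕ => initMeasure (Fin M × TParam B F)
          {θ | ε ≤ |empNTK (ensembleF σ B M) θ xi xj - L|})
        atTop (nhds 0)) := by
  refine ⟨SoftTree.N (dot xi xj * Tdot σ xi xj) (Tker σ xi xj) A, ?_, ?_⟩
  · intro ε hε
    simp only [SoftTree.empNTK_ensemble]
    exact SoftTree.wlln (SoftTree.K_mem hσ A xi xj) (SoftTree.K_mean hσ A xi xj).2 ε hε
  · intro ε hε
    rw [SoftTree.N_congr _ _ A B hQ]
    simp only [SoftTree.empNTK_ensemble]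
    exact SoftTree.wlln (SoftTree.K_mem hσ B xi xj) (SoftTree.K_mean hσ B xi xj).2 ε hε

end
end
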